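/- Packing entropy of generic points, ergodic case: Let (X,G) be a G-action topological dynamical system with G a countable infinite discrete amenable group, let μ be an ergodic G-invariant Borel probability measure on X, and let {F_n} be a tempered Følner sequence in G satisfying the growth condition. Then h^P_top(G_μ,{F_n}) = h_μ(X,G). -/

import Mathlib

open Filter Set MeasureTheory ENNReal Topology
open scoped Pointwise symmDiff NNReal

namespace AmenablePacking

variable {G X Y : Type*}

/-- The open dynamical (Bowen) ball of center `x` and radius `ε` over the finite set `F`. -/
def dynBall [PseudoMetricSpace X] (act : G → X → X) (F : Finset G) (x : X) (ε : ℝ) : Set X :=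
  {y | ∀ g ∈ F, dist (act g x) (act g y) < ε}

/-- The closed dynamical (Bowen) ball of center `x` and radius `ε` over the finite set `F`. -/
def dynClosedBall [PseudoMetricSpace X] (act : G → X → X) (F : Finset G) (x : X) (ε : ℝ) :
    Set X :=
  {y | ∀ g ∈ F, dist (act g x) (act g y) ≤ ε}

/-- The packing pre-measure `P(Z, N, ε, s, {F_n})`: the supremum of `∑ᵢ exp (- s |F_{n_i}|)` over
all finite or countable pairwise disjoint families of closed Bowen balls with centers in `Z`
and indices `n_i ≥ N`. -/
noncomputable def packP [PseudoMetricSpace X] (act : G → X → X) (Fs : ℕ → Finset G) (Z : Set X)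
    (N : ℕ) (ε s : ℝ) : ℝ≥0∞ :=
  ⨆ (t : Set ℕ) (c : ℕ → X × ℕ) (_ : ∀ i ∈ t, (c i).1 ∈ Z ∧ N ≤ (c i).2)
    (_ : ∀ i ∈ t, ∀ j ∈ t, i ≠ j →
      Disjoint (dynClosedBall act (Fs (c i).2) (c i).1 ε)
        (dynClosedBall act (Fs (c j).2) (c j).1 ε)),
    ∑' i : t, ENNReal.ofReal (Real.exp (-s * ((Fs (c (i : ℕ)).2).card : ℝ)))

/-- `P(Z, ε, s, {F_n}) = lim_{N → ∞} P(Z, N, ε, s, {F_n})`; the quantity is non-increasing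
in `N`, so the limit equals the infimum. -/
noncomputable def packPLim [PseudoMetricSpace X] (act : G → X → X) (Fs : ℕ → Finset G)
    (Z : Set X) (ε s : ℝ) : ℝ≥0∞ :=
  ⨅ N : ℕ, packP act Fs Z N ε s

/-- `𝒫(Z, ε, s, {F_n})`: the countably subadditive envelope of `P(·, ε, s, {F_n})`. -/
noncomputable def packOuter [PseudoMetricSpace X] (act : G → X → X) (Fs : ℕ → Finset G)
    (Z : Set X) (ε s : ℝ) : ℝ≥0∞ :=
  ⨅ (Zs : ℕ → Set X) (_ : Z ⊆ ⋃ i, Zs i), ∑' i, packPLim act Fs (Zs i) ε s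

/-- `h^P_top(Z, ε, {F_n})`: the critical value of `s ≥ 0` at which `𝒫(Z, ε, s, {F_n})` jumps
from `+∞` to `0`. -/
noncomputable def packEntEps [PseudoMetricSpace X] (act : G → X → X) (Fs : ℕ → Finset G)
    (Z : Set X) (ε : ℝ) : ℝ≥0∞ :=
  ⨅ (s : ℝ≥0) (_ : packOuter act Fs Z ε (s : ℝ) = 0), (s : ℝ≥0∞)

/-- The amenable packing topological entropy
`h^P_top(Z, {F_n}) = lim_{ε → 0} h^P_top(Z, ε, {F_n})`. -/
noncomputable def packEnt [PseudoMetricSpace X] (act : G → X → X) (Fs : ℕ → Finset G)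
    (Z : Set X) : ℝ≥0∞ :=
  ⨆ (ε : ℝ) (_ : 0 < ε), packEntEps act Fs Z ε

/-- The Bowen pre-measure `ℳ(Z, N, ε, s, {F_n})`: the infimum of `∑ᵢ exp (- s |F_{n_i}|)` over
all finite or countable families of open Bowen balls with indices `n_i ≥ N` covering `Z`. -/
noncomputable def bowenM [PseudoMetricSpace X] (act : G → X → X) (Fs : ℕ → Finset G) (Z : Set X)
    (N : ℕ) (ε s : ℝ) : ℝ≥0∞ :=
  ⨅ (t : Set ℕ) (c : ℕ → X × ℕ) (_ : ∀ i ∈ t, N ≤ (c i).2)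
    (_ : Z ⊆ ⋃ i ∈ t, dynBall act (Fs (c i).2) (c i).1 ε),
    ∑' i : t, ENNReal.ofReal (Real.exp (-s * ((Fs (c (i : ℕ)).2).card : ℝ)))

/-- `ℳ(Z, s, {F_n}) = lim_{ε → 0} lim_{N → ∞} ℳ(Z, N, ε, s, {F_n})`. -/
noncomputable def bowenMLim [PseudoMetricSpace X] (act : G → X → X) (Fs : ℕ → Finset G)
    (Z : Set X) (s : ℝ) : ℝ≥0∞ :=
  ⨆ (ε : ℝ) (_ : 0 < ε), ⨆ N : ℕ, bowenM act Fs Z N ε s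

/-- The amenable Bowen topological entropy `h^B_top(Z, {F_n})`: the critical value of `s ≥ 0`
at which `ℳ(Z, s, {F_n})` jumps from `+∞` to `0`. -/
noncomputable def bowenEnt [PseudoMetricSpace X] (act : G → X → X) (Fs : ℕ → Finset G)
    (Z : Set X) : ℝ≥0∞ :=
  ⨅ (s : ℝ≥0) (_ : bowenMLim act Fs Z (s : ℝ) = 0), (s : ℝ≥0∞)

/-- `E` is an `(F, ε)`-separated set: distinct points are at `d_F`-distance `> ε`. -/
def IsDynSeparated [PseudoMetricSpace X] (act : G → X → X) (F : Finset G) (ε : ℝ)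
    (E : Set X) : Prop :=
  ∀ x ∈ E, ∀ y ∈ E, x ≠ y → ∃ g ∈ F, ε < dist (act g x) (act g y)

/-- `s_F(Z, ε)`: the maximal cardinality of an `(F, ε)`-separated subset of `Z`. -/
noncomputable def sepNum [PseudoMetricSpace X] (act : G → X → X) (F : Finset G) (Z : Set X)
    (ε : ℝ) : ℕ :=
  sSup {k : ℕ | ∃ E : Finset X, ↑E ⊆ Z ∧ IsDynSeparated act F ε ↑E ∧ E.card = k}

/-- The upper capacity entropy of `Z` at scale `ε`:
`limsup_n (1/|F_n|) log s_{F_n}(Z, ε)`. -/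
noncomputable def ucEntEps [PseudoMetricSpace X] (act : G → X → X) (Fs : ℕ → Finset G)
    (Z : Set X) (ε : ℝ) : ℝ≥0∞ :=
  limsup (fun n => ENNReal.ofReal (Real.log ((sepNum act (Fs n) Z ε : ℝ)) / ((Fs n).card : ℝ)))
    atTop

/-- The upper capacity topological entropy `h^{UC}_top(Z, {F_n})`. -/
noncomputable def ucEnt [PseudoMetricSpace X] (act : G → X → X) (Fs : ℕ → Finset G)
    (Z : Set X) : ℝ≥0∞ :=
  ⨆ (ε : ℝ) (_ : 0 < ε), ucEntEps act Fs Z ε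

/-- The upper local entropy `h̄^loc_μ(Z, {F_n}) =
`∫_Z lim_{ε→0} limsup_n -(1/|F_n|) log μ(B_{F_n}(x, ε)) dμ`. -/
noncomputable def upperLocalEnt [PseudoMetricSpace X] [MeasurableSpace X] (act : G → X → X)
    (Fs : ℕ → Finset G) (μ : Measure X) (Z : Set X) : ℝ≥0∞ :=
  ∫⁻ x in Z, ⨆ (ε : ℝ) (_ : 0 < ε),
    limsup (fun n =>
      ENNReal.ofReal (-Real.log ((μ (dynBall act (Fs n) x ε)).toReal) / ((Fs n).card : ℝ)))
      atTop ∂μ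

/-- A Følner sequence: a sequence of nonempty finite subsets of `G` which is asymptotically
invariant, i.e. `|g F_n ∆ F_n| / |F_n| → 0` for every `g ∈ G`. -/
def Folner [Group G] [DecidableEq G] (Fs : ℕ → Finset G) : Prop :=
  (∀ n, (Fs n).Nonempty) ∧
    ∀ g : G,
      Tendsto (fun n => ((((Fs n).image fun h => g * h) ∆ Fs n).card : ℝ) / ((Fs n).card : ℝ))
        atTop (nhds 0)

/-- A tempered sequence: `|⋃_{k < n} F_k⁻¹ F_n| ≤ C |F_n|` for a constant `C > 0`. -/
def Tempered [Group G] [DecidableEq G] (Fs : ℕ → Finset G) : Prop :=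
  ∃ C : ℝ, 0 < C ∧
    ∀ n : ℕ, ((((Finset.range n).biUnion fun k => (Fs k)⁻¹ * Fs n).card : ℝ))
      ≤ C * ((Fs n).card : ℝ)

/-- The growth condition `lim_n |F_n| / log n = +∞`. -/
def GrowthCond (Fs : ℕ → Finset G) [Group G] : Prop :=
  Tendsto (fun n => ((Fs n).card : ℝ) / Real.log (n : ℝ)) atTop atTop

/-- The static (Shannon) entropy of the finite measurable partition of `X` induced by a map
into a finite set. -/
noncomputable def partEnt [MeasurableSpace X] (μ : Measure X) {ι : Type*} [Fintype ι]
    (P : X → ι) : ℝ :=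
  ∑ i : ι, Real.negMulLog ((μ (P ⁻¹' {i})).toReal)

/-- The measure-theoretic (Kolmogorov–Sinai) entropy `h_μ(X, G)` of the action w.r.t. the
invariant measure `μ`, computed along the Følner sequence `{F_n}`: the supremum over finite
measurable partitions `P` of `lim_n (1/|F_n|) H_μ(⋁_{g ∈ F_n} (act g)⁻¹ P)`. -/
noncomputable def measEnt [MeasurableSpace X] [DecidableEq G] (act : G → X → X)
    (Fs : ℕ → Finset G) (μ : Measure X) : ℝ≥0∞ :=
  ⨆ (k : ℕ) (P : X → Fin k) (_ : Measurable P),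
    limsup (fun n => ENNReal.ofReal
      ((partEnt μ fun x (g : (Fs n : Finset G)) => P (act (g : G) x)) / ((Fs n).card : ℝ)))
      atTop

/-- The set of generic points of `μ` w.r.t. `{F_n}`. -/
def genericPoints [TopologicalSpace X] [MeasurableSpace X] (act : G → X → X)
    (Fs : ℕ → Finset G) (μ : Measure X) : Set X :=
  {x | ∀ f : C(X, ℝ),
    Tendsto (fun n => (∑ g ∈ Fs n, f (act g x)) / ((Fs n).card : ℝ)) atTop
      (nhds (∫ y, f y ∂μ))}

/-- `μ` is invariant under the action. -/
def InvariantMeasure [MeasurableSpace X] (act : G → X → X) (μ : Measure X) : Prop :=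
  ∀ (g : G) (s : Set X), MeasurableSet s → μ (act g ⁻¹' s) = μ s

/-- The action is ergodic w.r.t. `μ`: every invariant measurable set is null or conull. -/
def ErgodicAction [MeasurableSpace X] (act : G → X → X) (μ : Measure X) : Prop :=
  ∀ s : Set X, MeasurableSet s → (∀ g : G, act g ⁻¹' s = s) → μ s = 0 ∨ μ s = 1

/-! ### Growth of Følner sequences -/

lemma tendsto_card_atTop [Group G] {Fs : ℕ → Finset G} (hgrow : GrowthCond Fs) :
    Tendsto (fun n => ((Fs n).card : ℝ)) atTop atTop := by
  have hlog : Tendsto (fun n : ℕ => Real.log (n : ℝ)) atTop atTop :=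
    Real.tendsto_log_atTop.comp tendsto_natCast_atTop_atTop
  refine (hgrow.atTop_mul_atTop₀ hlog).congr' ?_
  filter_upwards [hlog.eventually_gt_atTop 0] with n hn
  field_simp

lemma summable_exp_neg_card [Group G] {Fs : ℕ → Finset G} (hgrow : GrowthCond Fs) {δ : ℝ}
    (hδ : 0 < δ) : Summable fun n => Real.exp (-δ * ((Fs n).card : ℝ)) := by
  have hlog : Tendsto (fun n : ℕ => Real.log (n : ℝ)) atTop atTop :=
    Real.tendsto_log_atTop.comp tendsto_natCast_atTop_atTop
  refine summable_of_isBigO_nat (Real.summable_one_div_nat_pow.mpr one_lt_two) ?_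
  refine Asymptotics.IsBigO.of_bound 1 ?_
  filter_upwards [hlog.eventually_gt_atTop 0, hgrow.eventually_ge_atTop (2 / δ),
    eventually_gt_atTop 0] with n hn hn2 hn0
  have hn0' : (0 : ℝ) < n := by exact_mod_cast hn0
  rw [le_div_iff₀ hn, div_mul_eq_mul_div, div_le_iff₀ hδ] at hn2
  rw [Real.norm_of_nonneg (Real.exp_pos _).le, Real.norm_of_nonneg (by positivity), one_mul]
  calc Real.exp (-δ * (Fs n).card) ≤ Real.exp (-(2 * Real.log n)) := by
        apply Real.exp_le_exp.mpr; linarith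
    _ = 1 / (n : ℝ) ^ 2 := by
        rw [Real.exp_neg, two_mul, Real.exp_add, Real.exp_log hn0', one_div, sq]

lemma tsum_exp_neg_card_ne_top [Group G] {Fs : ℕ → Finset G} (hgrow : GrowthCond Fs) {δ : ℝ}
    (hδ : 0 < δ) : ∑' n, ENNReal.ofReal (Real.exp (-δ * ((Fs n).card : ℝ))) ≠ ∞ :=
  (summable_exp_neg_card hgrow hδ).tsum_ofReal_ne_top

/-! ### A fractional covering argument and the maximal inequality -/

/-- The coverage of a point by the fractional tiles selected greedily from the centers
`A 0, A 1, …`: a center in `A j` is selected, with weight `1 / |K j|`, if the coverage by the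
previous tiles is smaller than `1` on its whole `K j`-orbit. -/
noncomputable def coverage [Group G] (act : G → X → X) (K : ℕ → Finset G) (A : ℕ → Set X) :
    ℕ → X → ℝ≥0∞
  | 0 => 0
  | j + 1 => fun y => coverage act K A j y +
      (∑ g ∈ K j, (A j ∩ {x | ∀ g ∈ K j, coverage act K A j (act g x) < 1}).indicator 1
        (act g⁻¹ y)) / ((K j).card : ℝ≥0∞)

/-- The centers selected at step `j`. -/
def selected [Group G] (act : G → X → X) (K : ℕ → Finset G) (A : ℕ → Set X) (j : ℕ) : Set X :=
  A j ∩ {x | ∀ g ∈ K j, coverage act K A j (act g x) < 1}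

lemma InvariantMeasure.measurePreserving {act : G → X → X} [MeasurableSpace X] {μ : Measure X}
    (hinv : InvariantMeasure act μ) (hmeas : ∀ g, Measurable (act g)) (g : G) :
    MeasurePreserving (act g) μ μ :=
  ⟨hmeas g, Measure.ext fun s hs => by rw [Measure.map_apply (hmeas g) hs, hinv g s hs]⟩

section Maximal

variable [Group G] {act : G → X → X} {K : ℕ → Finset G} {A : ℕ → Set X}

lemma coverage_succ (j : ℕ) (y : X) : coverage act K A (j + 1) y = coverage act K A j y +
    (∑ g ∈ K j, (selected act K A j).indicator 1 (act g⁻¹ y)) / ((K j).card : ℝ≥0∞) := rfl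

lemma coverage_eq_sum (n : ℕ) (y : X) : coverage act K A n y = ∑ j ∈ Finset.range n,
    (∑ g ∈ K j, (selected act K A j).indicator 1 (act g⁻¹ y)) / ((K j).card : ℝ≥0∞) := by
  induction n with
  | zero => simp [coverage]
  | succ n ih => rw [coverage_succ, ih, Finset.sum_range_succ]

lemma coverage_le_two (hact_one : ∀ x, act 1 x = x)
    (hact_mul : ∀ g h x, act (g * h) x = act g (act h x)) (n : ℕ) (y : X) :
    coverage act K A n y ≤ 2 := by
  induction n with
  | zero => simp [coverage]
  | succ n ih =>
    rw [coverage_succ]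
    by_cases h : coverage act K A n y < 1
    · have h1 : ∑ g ∈ K n, (selected act K A n).indicator (1 : X → ℝ≥0∞) (act g⁻¹ y)
          ≤ ((K n).card : ℝ≥0∞) := by
        refine (Finset.sum_le_card_nsmul _ _ 1 fun g _ => ?_).trans_eq (by simp)
        exact indicator_le_self' (fun _ _ => zero_le) _
      calc _ ≤ (1 : ℝ≥0∞) + 1 := add_le_add h.le (ENNReal.div_le_of_le_mul (by simpa using h1))
        _ = 2 := one_add_one_eq_two
    · have h0 : ∑ g ∈ K n, (selected act K A n).indicator (1 : X → ℝ≥0∞) (act g⁻¹ y) = 0 := by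
        refine Finset.sum_eq_zero fun g hg => indicator_of_notMem (fun hs => h ?_) _
        have := hs.2 g hg
        rwa [← hact_mul, mul_inv_cancel, hact_one] at this
      rw [h0]
      simpa using ih

variable [MeasurableSpace X] {μ : Measure X}

lemma measurable_coverage (hmeas : ∀ g, Measurable (act g)) (hA : ∀ j, MeasurableSet (A j))
    (n : ℕ) : Measurable (coverage act K A n) ∧ MeasurableSet (selected act K A n) := by
  have key : ∀ n, Measurable (coverage act K A n) → MeasurableSet (selected act K A n) := by
    intro n hn
    refine (hA n).inter ?_
    have : {x | ∀ g ∈ K n, coverage act K A n (act g x) < 1} =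
        ⋂ g ∈ K n, {x | coverage act K A n (act g x) < 1} := by ext; simp
    rw [this]
    exact Finset.measurableSet_biInter _ fun g _ =>
      measurableSet_lt (hn.comp (hmeas g)) measurable_const
  suffices h : Measurable (coverage act K A n) from ⟨h, key n h⟩
  induction n with
  | zero => exact measurable_const
  | succ n ih =>
    refine ih.add (Measurable.div_const (Finset.measurable_fun_sum _ fun g _ => ?_) _)
    exact (measurable_one.indicator (key n ih)).comp (hmeas g⁻¹)

lemma lintegral_coverage_mul (hact_one : ∀ x, act 1 x = x)
    (hact_mul : ∀ g h x, act (g * h) x = act g (act h x)) (hmeas : ∀ g, Measurable (act g))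
    (hinv : InvariantMeasure act μ) (hA : ∀ j, MeasurableSet (A j)) {f : X → ℝ≥0∞}
    (hf : Measurable f) (N : ℕ) :
    ∫⁻ y, coverage act K A N y * f y ∂μ = ∑ j ∈ Finset.range N,
      ∫⁻ x in selected act K A j, (∑ g ∈ K j, f (act g x)) / ((K j).card : ℝ≥0∞) ∂μ := by
  have hind : ∀ j g, Measurable fun y =>
      (selected act K A j).indicator (1 : X → ℝ≥0∞) (act g y) := fun j g =>
    (measurable_one.indicator (measurable_coverage hmeas hA j).2).comp (hmeas g)
  have hterm : ∀ j g, Measurable fun y => (selected act K A j).indicator (1 : X → ℝ≥0∞)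
      (act g⁻¹ y) * ((K j).card : ℝ≥0∞)⁻¹ * f y := fun j g =>
    ((hind j g⁻¹).mul_const _).mul hf
  have hterm' : ∀ j g, Measurable fun x => f (act g x) * ((K j).card : ℝ≥0∞)⁻¹ := fun j g =>
    (hf.comp (hmeas g)).mul_const _
  simp_rw [coverage_eq_sum, Finset.sum_mul, div_eq_mul_inv, Finset.sum_mul]
  rw [lintegral_finsetSum _ fun j _ => Finset.measurable_fun_sum _ fun g _ => hterm j g]
  refine Finset.sum_congr rfl fun j _ => ?_
  rw [lintegral_finsetSum _ fun g _ => hterm j g, lintegral_finsetSum _ fun g _ => hterm' j g]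
  refine Finset.sum_congr rfl fun g _ => ?_
  rw [← (hinv.measurePreserving hmeas g).lintegral_comp (hterm j g),
    ← lintegral_indicator (measurable_coverage hmeas hA j).2]
  refine lintegral_congr fun x => ?_
  simp only [← hact_mul, inv_mul_cancel, hact_one]
  by_cases hx : x ∈ selected act K A j <;> simp [hx, mul_comm]

lemma measure_iUnion_le_selected [DecidableEq G]
    (hact_mul : ∀ g h x, act (g * h) x = act g (act h x)) (hmeas : ∀ g, Measurable (act g))
    (hinv : InvariantMeasure act μ) (hA : ∀ j, MeasurableSet (A j)) (N : ℕ) {C : ℝ≥0∞}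
    (hC : ∀ j < N, (((Finset.Ioo j N).biUnion fun i => (K j)⁻¹ * K i).card : ℝ≥0∞)
      ≤ C * (K j).card) :
    μ (⋃ j ∈ Finset.range N, A j) ≤ (1 + C) * ∑ j ∈ Finset.range N, μ (selected act K A j) := by
  set U : ℕ → Finset G := fun j => (Finset.Ioo j N).biUnion fun i => (K j)⁻¹ * K i with hU
  have hs := fun j => (measurable_coverage (K := K) hmeas hA j).2
  have hind : ∀ j g, Measurable fun y =>
      (selected act K A j).indicator (1 : X → ℝ≥0∞) (act g y) := fun j g =>
    (measurable_one.indicator (hs j)).comp (hmeas g)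
  have hpt : ∀ x, (⋃ j ∈ Finset.range N, A j).indicator (1 : X → ℝ≥0∞) x ≤
      ∑ j ∈ Finset.range N, ((selected act K A j).indicator 1 x +
        (∑ u ∈ U j, (selected act K A j).indicator 1 (act u x)) / ((K j).card : ℝ≥0∞)) := by
    intro x
    refine indicator_apply_le' (fun hx => ?_) fun _ => zero_le
    simp only [mem_iUnion, Finset.mem_range] at hx
    obtain ⟨i, hiN, hi⟩ := hx
    rw [Pi.one_apply]
    by_cases hsel : x ∈ selected act K A i
    · refine le_trans ?_ (Finset.single_le_sum (f := fun j =>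
        (selected act K A j).indicator (1 : X → ℝ≥0∞) x +
          (∑ u ∈ U j, (selected act K A j).indicator 1 (act u x)) / ((K j).card : ℝ≥0∞))
        (fun _ _ => zero_le) (Finset.mem_range.mpr hiN))
      simp [hsel]
    · have : ∃ g ∈ K i, 1 ≤ coverage act K A i (act g x) := by
        by_contra! hcon
        exact hsel ⟨hi, hcon⟩
      obtain ⟨g, hg, hcov⟩ := this
      rw [coverage_eq_sum] at hcov
      refine hcov.trans ?_
      refine (Finset.sum_le_sum fun j hj => ?_).trans
        (Finset.sum_le_sum_of_subset (Finset.range_subset_range.mpr hiN.le))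
      rw [Finset.mem_range] at hj
      refine le_trans ?_ le_add_self
      refine ENNReal.div_le_div_right ?_ _
      have hinj : Set.InjOn (fun h : G => h⁻¹ * g) (K j) := fun a _ b _ hab => by simpa using hab
      simp_rw [← hact_mul]
      rw [← Finset.sum_image (f := fun u => (selected act K A j).indicator (1 : X → ℝ≥0∞)
        (act u x)) hinj]
      refine Finset.sum_le_sum_of_subset fun u hu => ?_
      obtain ⟨h, hh, rfl⟩ := Finset.mem_image.mp hu
      exact Finset.mem_biUnion.mpr ⟨i, Finset.mem_Ioo.mpr ⟨hj, hiN⟩,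
        Finset.mul_mem_mul (Finset.inv_mem_inv hh) hg⟩
  have hlint : ∀ j g, ∫⁻ x, (selected act K A j).indicator (1 : X → ℝ≥0∞) (act g x) ∂μ
      = μ (selected act K A j) := fun j g => by
    rw [(hinv.measurePreserving hmeas g).lintegral_comp (measurable_one.indicator (hs j)),
      lintegral_indicator_one (hs j)]
  rw [← lintegral_indicator_one (Finset.measurableSet_biUnion _ fun j _ => hA j)]
  refine (lintegral_mono hpt).trans ?_
  have hterm : ∀ j, Measurable fun x => (selected act K A j).indicator (1 : X → ℝ≥0∞) x +
      (∑ u ∈ U j, (selected act K A j).indicator 1 (act u x)) / ((K j).card : ℝ≥0∞) := fun j =>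
    (measurable_one.indicator (hs j)).add
      (Measurable.div_const (Finset.measurable_fun_sum _ fun g _ => hind j g) _)
  rw [lintegral_finsetSum _ fun j _ => hterm j, Finset.mul_sum]
  refine Finset.sum_le_sum fun j hj => ?_
  rw [lintegral_add_left (measurable_one.indicator (hs j)), lintegral_indicator_one (hs j),
    add_mul, one_mul]
  refine add_le_add_right ?_ _
  simp_rw [div_eq_mul_inv]
  rw [lintegral_mul_const _ (Finset.measurable_fun_sum _ fun g _ => hind j g),
    lintegral_finsetSum _ fun g _ => hind j g, ← div_eq_mul_inv]
  simp_rw [hlint]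
  rw [Finset.sum_const, nsmul_eq_mul]
  refine ENNReal.div_le_of_le_mul ?_
  calc _ ≤ C * (K j).card * μ (selected act K A j) := by
        gcongr
        exact hC j (Finset.mem_range.mp hj)
    _ = _ := by ring

/-- The weak type `(1, 1)` maximal inequality along a tempered sequence. -/
theorem maximal_inequality [DecidableEq G] (hact_one : ∀ x, act 1 x = x)
    (hact_mul : ∀ g h x, act (g * h) x = act g (act h x)) (hmeas : ∀ g, Measurable (act g))
    (hinv : InvariantMeasure act μ) {Fs : ℕ → Finset G} {C : ℝ≥0∞}
    (hC : ∀ n, (((Finset.range n).biUnion fun k => (Fs k)⁻¹ * Fs n).card : ℝ≥0∞)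
      ≤ C * (Fs n).card) {f : X → ℝ≥0∞} (hf : Measurable f) (r : ℝ≥0∞) :
    r * μ {x | ∃ n, r < (∑ g ∈ Fs n, f (act g x)) / ((Fs n).card : ℝ≥0∞)} ≤
      2 * (1 + C) * ∫⁻ x, f x ∂μ := by
  set E : ℕ → Set X := fun n => {x | r < (∑ g ∈ Fs n, f (act g x)) / ((Fs n).card : ℝ≥0∞)}
    with hE
  have hEm : ∀ n, MeasurableSet (E n) := fun n => measurableSet_lt measurable_const
    (Measurable.div_const (Finset.measurable_fun_sum _ fun g _ => hf.comp (hmeas g)) _)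
  have hfin : ∀ N, r * μ (⋃ n ∈ Finset.range N, E n) ≤ 2 * (1 + C) * ∫⁻ x, f x ∂μ := by
    intro N
    set K : ℕ → Finset G := fun j => Fs (N - 1 - j)
    set A : ℕ → Set X := fun j => E (N - 1 - j)
    have hAm : ∀ j, MeasurableSet (A j) := fun j => hEm _
    have hcard : ∀ j < N, (((Finset.Ioo j N).biUnion fun i => (K j)⁻¹ * K i).card : ℝ≥0∞)
        ≤ C * (K j).card := by
      intro j hj
      refine le_trans ?_ (hC (N - 1 - j))
      rw [← Finset.card_inv]
      norm_cast
      refine Finset.card_le_card fun u hu => ?_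
      obtain ⟨i, hi, hu⟩ := Finset.mem_biUnion.mp (Finset.mem_inv'.mp hu)
      rw [Finset.mem_Ioo] at hi
      refine Finset.mem_biUnion.mpr ⟨N - 1 - i, Finset.mem_range.mpr (by omega), ?_⟩
      have := Finset.inv_mem_inv hu
      simpa [mul_inv_rev, K] using this
    have hunion : (⋃ n ∈ Finset.range N, E n) = ⋃ j ∈ Finset.range N, A j := by
      ext x
      simp only [mem_iUnion, Finset.mem_range, A]
      constructor
      · rintro ⟨n, hn, hx⟩
        exact ⟨N - 1 - n, by omega, by rwa [show N - 1 - (N - 1 - n) = n by omega]⟩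
      · rintro ⟨j, hj, hx⟩
        exact ⟨N - 1 - j, by omega, hx⟩
    have h1 := measure_iUnion_le_selected hact_mul hmeas hinv hAm N hcard
    have h2 := lintegral_coverage_mul (K := K) hact_one hact_mul hmeas hinv hAm hf N
    have h3 : r * ∑ j ∈ Finset.range N, μ (selected act K A j) ≤ 2 * ∫⁻ x, f x ∂μ := by
      rw [Finset.mul_sum]
      calc ∑ j ∈ Finset.range N, r * μ (selected act K A j)
          ≤ ∑ j ∈ Finset.range N, ∫⁻ x in selected act K A j,
            (∑ g ∈ K j, f (act g x)) / ((K j).card : ℝ≥0∞) ∂μ := by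
            refine Finset.sum_le_sum fun j _ => ?_
            rw [← setLIntegral_const]
            refine setLIntegral_mono' (measurable_coverage hmeas hAm j).2 fun x hx => ?_
            exact (show x ∈ E (N - 1 - j) from hx.1).le
        _ = ∫⁻ y, coverage act K A N y * f y ∂μ := h2.symm
        _ ≤ ∫⁻ y, 2 * f y ∂μ := by
            refine lintegral_mono fun y => ?_
            exact mul_le_mul_left (coverage_le_two hact_one hact_mul N y) _
        _ = 2 * ∫⁻ x, f x ∂μ := lintegral_const_mul _ hf
    calc r * μ (⋃ n ∈ Finset.range N, E n)
        ≤ r * ((1 + C) * ∑ j ∈ Finset.range N, μ (selected act K A j)) := by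
          rw [hunion]; gcongr
      _ = (1 + C) * (r * ∑ j ∈ Finset.range N, μ (selected act K A j)) := by ring
      _ ≤ (1 + C) * (2 * ∫⁻ x, f x ∂μ) := by gcongr
      _ = _ := by ring
  have hset : {x | ∃ n, r < (∑ g ∈ Fs n, f (act g x)) / ((Fs n).card : ℝ≥0∞)} =
      ⋃ N, ⋃ n ∈ Finset.range N, E n := by
    ext x
    simp only [mem_ofPred_eq, mem_iUnion, Finset.mem_range, E]
    exact ⟨fun ⟨n, hn⟩ => ⟨n + 1, n, n.lt_succ_self, hn⟩, fun ⟨_, n, _, hn⟩ => ⟨n, hn⟩⟩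
  have hmono : Monotone fun N => ⋃ n ∈ Finset.range N, E n := fun M N hMN =>
    biUnion_subset_biUnion_left (by simpa using hMN)
  rw [hset, hmono.measure_iUnion, ENNReal.mul_iSup]
  exact iSup_le hfin

end Maximal

/-! ### The pointwise ergodic theorem -/

/-- The average of `f` along the `F`-orbit of `x`. -/
noncomputable def orbitAvg (act : G → X → X) (F : Finset G) (f : X → ℝ) (x : X) : ℝ :=
  (∑ g ∈ F, f (act g x)) / (F.card : ℝ)

lemma orbitAvg_add (act : G → X → X) (F : Finset G) (f₁ f₂ : X → ℝ) (x : X) :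
    orbitAvg act F (f₁ + f₂) x = orbitAvg act F f₁ x + orbitAvg act F f₂ x := by
  simp [orbitAvg, Finset.sum_add_distrib, add_div]

lemma orbitAvg_smul (act : G → X → X) (F : Finset G) (c : ℝ) (f : X → ℝ) (x : X) :
    orbitAvg act F (c • f) x = c * orbitAvg act F f x := by
  simp [orbitAvg, ← Finset.mul_sum, mul_div_assoc]

lemma abs_orbitAvg_le (act : G → X → X) (F : Finset G) (f : X → ℝ) (x : X) :
    |orbitAvg act F f x| ≤ orbitAvg act F (fun y => |f y|) x := by
  rw [orbitAvg, orbitAvg, abs_div, Nat.abs_cast]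
  gcongr
  exact Finset.abs_sum_le_sum_abs _ _

lemma ofReal_orbitAvg_abs {act : G → X → X} {F : Finset G} (hF : F.Nonempty) (f : X → ℝ) (x : X) :
    ENNReal.ofReal (orbitAvg act F (fun y => |f y|) x) =
      (∑ g ∈ F, ‖f (act g x)‖ₑ) / (F.card : ℝ≥0∞) := by
  rw [orbitAvg, ENNReal.ofReal_div_of_pos (by exact_mod_cast hF.card_pos),
    ENNReal.ofReal_sum_of_nonneg fun _ _ => abs_nonneg _, ENNReal.ofReal_natCast]
  simp_rw [Real.enorm_eq_ofReal_abs]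

/-- The orbit average of the coboundary of a function bounded by `1` is controlled by the relative
size of the difference of `F` and its left translate. -/
lemma abs_orbitAvg_sub_le [Group G] [DecidableEq G] {act : G → X → X}
    (hact_mul : ∀ g h x, act (g * h) x = act g (act h x)) (F : Finset G) {φ : X → ℝ}
    (hφ : ∀ x, |φ x| ≤ 1) (g : G) (x : X) :
    |orbitAvg act F (fun y => φ y - φ (act g y)) x| ≤
      (((F.image fun h => g * h) ∆ F).card : ℝ) / (F.card : ℝ) := by
  rw [orbitAvg, abs_div, Nat.abs_cast]
  gcongr
  have h1 : ∑ h ∈ F, φ (act g (act h x)) = ∑ h ∈ F.image (fun h => g * h), φ (act h x) := by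
    rw [Finset.sum_image fun a _ b _ hab => by simpa using hab]
    simp_rw [hact_mul]
  rw [Finset.sum_sub_distrib, h1]
  set F' := F.image fun h => g * h
  rw [← Finset.sum_sdiff_sub_sum_sdiff]
  calc |∑ h ∈ F \ F', φ (act h x) - ∑ h ∈ F' \ F, φ (act h x)|
      ≤ |∑ h ∈ F \ F', φ (act h x)| + |∑ h ∈ F' \ F, φ (act h x)| := abs_sub _ _
    _ ≤ ∑ h ∈ F \ F', 1 + ∑ h ∈ F' \ F, 1 := by
        gcongr
        · exact (Finset.abs_sum_le_sum_abs _ _).trans (Finset.sum_le_sum fun _ _ => hφ _)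
        · exact (Finset.abs_sum_le_sum_abs _ _).trans (Finset.sum_le_sum fun _ _ => hφ _)
    _ = ((F' ∆ F).card : ℝ) := by
        rw [Finset.symmDiff_def, Finset.card_union_of_disjoint
          (disjoint_sdiff_sdiff)]
        simp [add_comm]

section Ergodic

variable [Group G] [MeasurableSpace X] {μ : Measure X} {act : G → X → X}

lemma ae_integral_le_of_invariant [Countable G] [IsProbabilityMeasure μ]
    (hact_mul : ∀ g h x, act (g * h) x = act g (act h x)) (hmeas : ∀ g, Measurable (act g))
    (herg : ErgodicAction act μ) {ψ : X → ℝ} (hψ : Measurable ψ) (hint : Integrable ψ μ)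
    (hψinv : ∀ g, ∀ᵐ x ∂μ, ψ (act g x) = ψ x) : ∀ᵐ x ∂μ, ∫ y, ψ y ∂μ ≤ ψ x := by
  set m := ∫ y, ψ y ∂μ with hm
  set s : Set X := ⋂ g, {x | ψ (act g x) < m} with hs
  have hsm : MeasurableSet s := MeasurableSet.iInter fun g =>
    measurableSet_lt (hψ.comp (hmeas g)) measurable_const
  have hsinv : ∀ g, act g ⁻¹' s = s := by
    intro g
    ext x
    simp only [hs, mem_preimage, mem_iInter, mem_ofPred_eq, ← hact_mul]
    exact ⟨fun h k => by simpa using h (k * g⁻¹), fun h k => h _⟩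
  have hae : ∀ᵐ x ∂μ, ∀ g, ψ (act g x) = ψ x := ae_all_iff.mpr hψinv
  rcases herg s hsm hsinv with h0 | h1
  · have : ∀ᵐ x ∂μ, x ∉ s := measure_eq_zero_iff_ae_notMem.mp h0
    filter_upwards [this, hae] with x hx hx2
    simp only [hs, mem_iInter, mem_ofPred_eq, not_forall, not_lt] at hx
    obtain ⟨g, hg⟩ := hx
    rwa [hx2 g] at hg
  · have : ∀ᵐ x ∂μ, x ∈ s := (mem_ae_iff_prob_eq_one hsm).mpr h1
    have hlt : ∀ᵐ x ∂μ, ψ x < m := by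
      filter_upwards [this, hae] with x hx hx2
      have := mem_iInter.mp hx 1
      rwa [mem_ofPred_eq, hx2 1] at this
    have hpos : 0 < ∫ x, (m - ψ x) ∂μ := by
      rw [integral_pos_iff_support_of_nonneg_ae (hlt.mono fun x hx => (sub_pos.mpr hx).le)
        ((integrable_const _).sub hint)]
      have : Function.support (fun x => m - ψ x) =ᵐ[μ] univ := by
        rw [eventuallyEq_univ]
        exact hlt.mono fun x hx => (sub_pos.mpr hx).ne'
      rw [measure_congr this]
      simp
    rw [integral_sub (integrable_const _) hint] at hpos
    simp [hm] at hpos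

lemma ae_eq_integral_of_invariant [Countable G] [IsProbabilityMeasure μ]
    (hact_mul : ∀ g h x, act (g * h) x = act g (act h x)) (hmeas : ∀ g, Measurable (act g))
    (herg : ErgodicAction act μ) {ψ : X → ℝ} (hψ : Measurable ψ) (hint : Integrable ψ μ)
    (hψinv : ∀ g, ∀ᵐ x ∂μ, ψ (act g x) = ψ x) : ∀ᵐ x ∂μ, ψ x = ∫ y, ψ y ∂μ := by
  have h1 := ae_integral_le_of_invariant hact_mul hmeas herg hψ hint hψinv
  have h2 := ae_integral_le_of_invariant hact_mul hmeas herg hψ.neg hint.neg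
    fun g => (hψinv g).mono fun x hx => by simp [hx]
  filter_upwards [h1, h2] with x hx1 hx2
  simp only [Pi.neg_apply, integral_neg] at hx2
  linarith

lemma ae_invariant_of_setIntegral [IsProbabilityMeasure μ] (hact_one : ∀ x, act 1 x = x)
    (hact_mul : ∀ g h x, act (g * h) x = act g (act h x)) (hmeas : ∀ g, Measurable (act g))
    (hinv : InvariantMeasure act μ) {ψ : X → ℝ} (hint : Integrable ψ μ)
    (h : ∀ g s, MeasurableSet s → ∫ x in s, ψ x ∂μ = ∫ x in act g ⁻¹' s, ψ x ∂μ) (g : G) :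
    ∀ᵐ x ∂μ, ψ (act g x) = ψ x := by
  have hmp := hinv.measurePreserving hmeas
  refine ae_eq_of_forall_setIntegral_eq_of_sigmaFinite
    (fun s _ _ => ((hmp g).integrable_comp_of_integrable hint).integrableOn)
    (fun s _ _ => hint.integrableOn) fun s hs _ => ?_
  let e : X ≃ᵐ X :=
    { toFun := act g
      invFun := act g⁻¹
      left_inv := fun x => by rw [← hact_mul, inv_mul_cancel, hact_one]
      right_inv := fun x => by rw [← hact_mul, mul_inv_cancel, hact_one]
      measurable_toFun := hmeas g
      measurable_invFun := hmeas g⁻¹ }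
  have h2 : s = act g ⁻¹' (act g⁻¹ ⁻¹' s) := by
    ext x
    simp only [mem_preimage, ← hact_mul, inv_mul_cancel, hact_one]
  conv_lhs => rw [h2]
  rw [h g⁻¹ s hs]
  exact (hmp g).setIntegral_preimage_emb e.measurableEmbedding ψ _

/-- Coboundaries of indicator functions span a dense subspace of the mean zero functions. -/
lemma exists_coboundary_approx [DecidableEq G] [Countable G] [IsProbabilityMeasure μ]
    (hact_one : ∀ x, act 1 x = x)
    (hact_mul : ∀ g h x, act (g * h) x = act g (act h x)) (hmeas : ∀ g, Measurable (act g))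
    (hinv : InvariantMeasure act μ) (herg : ErgodicAction act μ) {Fs : ℕ → Finset G}
    (hFol : Folner Fs) {f : X → ℝ} (hf : MemLp f 2 μ) (hf0 : ∫ x, f x ∂μ = 0) {η : ℝ≥0∞}
    (hη : 0 < η) :
    ∃ b : X → ℝ, Measurable b ∧ (∀ x, Tendsto (fun n => orbitAvg act (Fs n) b x) atTop (𝓝 0)) ∧
      ∫⁻ x, ‖f x - b x‖ₑ ∂μ < η := by
  set ind : {s : Set X // MeasurableSet s} → Lp ℝ 2 μ :=
    fun s => indicatorConstLp 2 s.2 (measure_ne_top μ s.1) (1 : ℝ) with hind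
  set S : Set (Lp ℝ 2 μ) := range fun p : {s : Set X // MeasurableSet s} × G =>
    ind p.1 - ind ⟨act p.2 ⁻¹' p.1.1, hmeas p.2 p.1.2⟩ with hS
  set M : Submodule ℝ (Lp ℝ 2 μ) := Submodule.span ℝ S with hM
  have hrep : ∀ b ∈ M, ∃ b' : X → ℝ, Measurable b' ∧ b =ᵐ[μ] b' ∧
      ∀ x, Tendsto (fun n => orbitAvg act (Fs n) b' x) atTop (𝓝 0) := by
    intro b hb
    induction hb using Submodule.span_induction with
    | mem b hb =>
      obtain ⟨⟨⟨s, hs⟩, g⟩, rfl⟩ := hb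
      refine ⟨fun x => s.indicator 1 x - s.indicator 1 (act g x),
        (measurable_one.indicator hs).sub ((measurable_one.indicator hs).comp (hmeas g)), ?_,
        fun x => ?_⟩
      · refine (Lp.coeFn_sub _ _).trans ?_
        filter_upwards [indicatorConstLp_coeFn (p := 2) (hs := hs) (hμs := measure_ne_top μ s)
          (c := (1 : ℝ)), indicatorConstLp_coeFn (p := 2) (hs := hmeas g hs)
          (hμs := measure_ne_top μ (act g ⁻¹' s)) (c := (1 : ℝ))] with x hx1 hx2
        rw [Pi.sub_apply, hx1, hx2]
        rfl
      · refine squeeze_zero_norm (fun n => ?_) (hFol.2 g)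
        refine abs_orbitAvg_sub_le hact_mul (Fs n) (fun y => ?_) g x
        by_cases hy : y ∈ s <;> simp [hy]
    | zero => exact ⟨0, measurable_const, Lp.coeFn_zero _ _ _, fun x => by simp [orbitAvg]⟩
    | add b₁ b₂ _ _ h₁ h₂ =>
      obtain ⟨c₁, hm₁, he₁, ht₁⟩ := h₁
      obtain ⟨c₂, hm₂, he₂, ht₂⟩ := h₂
      refine ⟨c₁ + c₂, hm₁.add hm₂, (Lp.coeFn_add _ _).trans (he₁.add he₂), fun x => ?_⟩
      simpa [orbitAvg_add] using (ht₁ x).add (ht₂ x)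
    | smul a b _ h =>
      obtain ⟨c, hm, he, ht⟩ := h
      refine ⟨a • c, hm.const_smul a, (Lp.coeFn_smul _ _).trans (he.const_smul a), fun x => ?_⟩
      simpa [orbitAvg_smul] using (ht x).const_mul a
  have hmem : hf.toLp f ∈ M.topologicalClosure := by
    rw [← Submodule.orthogonal_orthogonal_eq_closure, Submodule.mem_orthogonal]
    intro ψ hψ
    have hψL1 : Integrable ψ μ := (Lp.memLp ψ).integrable one_le_two
    have hψinv := ae_invariant_of_setIntegral hact_one hact_mul hmeas hinv hψL1 (by
      intro g s hs
      have h0 : inner ℝ (ind ⟨s, hs⟩ - ind ⟨act g ⁻¹' s, hmeas g hs⟩) ψ = 0 :=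
        (Submodule.mem_orthogonal _ _).mp hψ _
          (Submodule.subset_span ⟨⟨⟨s, hs⟩, g⟩, rfl⟩)
      rw [inner_sub_left, sub_eq_zero] at h0
      simpa [hind, L2.inner_indicatorConstLp_one] using h0)
    have hc := ae_eq_integral_of_invariant hact_mul hmeas herg
      (Lp.stronglyMeasurable ψ).measurable hψL1 hψinv
    rw [L2.inner_def]
    have : ∫ x, inner ℝ (ψ x) (hf.toLp f x) ∂μ = ∫ x, (∫ y, ψ y ∂μ) * f x ∂μ := by
      refine integral_congr_ae ?_
      filter_upwards [hc, hf.coeFn_toLp] with x hx1 hx2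
      rw [hx2, hx1]
      simp [mul_comm]
    rw [this, integral_const_mul, hf0, mul_zero]
  obtain ⟨b, hb, hdist⟩ := EMetric.mem_closure_iff.mp hmem η hη
  obtain ⟨b', hb'm, hbb', hb't⟩ := hrep b hb
  refine ⟨b', hb'm, hb't, ?_⟩
  have h1 : ∫⁻ x, ‖f x - b' x‖ₑ ∂μ = eLpNorm (f - b') 1 μ := by
    rw [eLpNorm_one_eq_lintegral_enorm]; rfl
  have h2 : eLpNorm (f - b') 2 μ = edist (hf.toLp f) b := by
    rw [Lp.edist_def]
    exact eLpNorm_congr_ae (hf.coeFn_toLp.symm.sub hbb'.symm)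
  rw [h1]
  refine (eLpNorm_le_eLpNorm_of_exponent_le one_le_two
    (hf.aestronglyMeasurable.sub hb'm.aestronglyMeasurable)).trans_lt ?_
  rw [h2]
  exact hdist

/-- The pointwise ergodic theorem for square integrable functions of mean zero. -/
lemma ae_tendsto_orbitAvg_zero [DecidableEq G] [Countable G] [IsProbabilityMeasure μ]
    (hact_one : ∀ x, act 1 x = x)
    (hact_mul : ∀ g h x, act (g * h) x = act g (act h x)) (hmeas : ∀ g, Measurable (act g))
    (hinv : InvariantMeasure act μ) (herg : ErgodicAction act μ) {Fs : ℕ → Finset G}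
    (hFol : Folner Fs) (htemp : Tempered Fs) {f : X → ℝ} (hfm : Measurable f)
    (hf : MemLp f 2 μ) (hf0 : ∫ x, f x ∂μ = 0) :
    ∀ᵐ x ∂μ, Tendsto (fun n => orbitAvg act (Fs n) f x) atTop (𝓝 0) := by
  obtain ⟨C, hC0, hC⟩ := htemp
  have hC' : ∀ n, (((Finset.range n).biUnion fun k => (Fs k)⁻¹ * Fs n).card : ℝ≥0∞)
      ≤ ENNReal.ofReal C * (Fs n).card := by
    intro n
    rw [← ENNReal.ofReal_natCast, ← ENNReal.ofReal_natCast, ← ENNReal.ofReal_mul hC0.le]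
    exact ENNReal.ofReal_le_ofReal (hC n)
  set D : ℝ≥0∞ := 2 * (1 + ENNReal.ofReal C) with hD
  have hDtop : D ≠ ∞ := by finiteness
  have key : ∀ r : ℝ, 0 < r →
      ∀ᵐ x ∂μ, ∀ᶠ n in atTop, |orbitAvg act (Fs n) f x| ≤ 2 * r := by
    intro r hr
    have hr' : ENNReal.ofReal r ≠ 0 := by simpa using hr
    rw [ae_iff]
    refine le_antisymm (ENNReal.le_of_forall_pos_le_add fun η hη _ => ?_) zero_le
    rw [zero_add]
    have hη' : 0 < ENNReal.ofReal r * η / D := by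
      refine ENNReal.div_pos (mul_ne_zero hr' (by simpa using hη.ne')) hDtop
    obtain ⟨b, hbm, hbt, hlt⟩ := exists_coboundary_approx hact_one hact_mul hmeas hinv herg hFol
      hf hf0 hη'
    have hmax := maximal_inequality hact_one hact_mul hmeas hinv hC'
      (f := fun x => ‖f x - b x‖ₑ) (hfm.sub hbm).enorm (ENNReal.ofReal r)
    have hsub : {x | ¬ ∀ᶠ n in atTop, |orbitAvg act (Fs n) f x| ≤ 2 * r} ⊆
        {x | ∃ n, ENNReal.ofReal r < (∑ g ∈ Fs n, ‖f (act g x) - b (act g x)‖ₑ) /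
          ((Fs n).card : ℝ≥0∞)} := by
      intro x hx
      by_contra hcon
      simp only [mem_ofPred_eq, not_exists, not_lt] at hcon
      refine hx ?_
      filter_upwards [(hbt x).abs.eventually (gt_mem_nhds (by simpa using hr))] with n hn
      have h1 := hcon n
      rw [← ofReal_orbitAvg_abs (f := fun x => f x - b x) (hFol.1 n),
        ENNReal.ofReal_le_ofReal_iff hr.le] at h1
      have h2 := (abs_orbitAvg_le act (Fs n) (fun x => f x - b x) x).trans h1
      have h3 : orbitAvg act (Fs n) f x =
          orbitAvg act (Fs n) b x + orbitAvg act (Fs n) (fun x => f x - b x) x := by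
        rw [← orbitAvg_add]
        congr 1
        ext y
        simp
      rw [h3]
      refine (abs_add_le _ _).trans ?_
      linarith
    have h4 : ENNReal.ofReal r * μ {x | ¬ ∀ᶠ n in atTop, |orbitAvg act (Fs n) f x| ≤ 2 * r} ≤
        ENNReal.ofReal r * η := by
      calc _ ≤ D * ∫⁻ x, ‖f x - b x‖ₑ ∂μ := le_trans (by gcongr) hmax
        _ ≤ D * (ENNReal.ofReal r * η / D) := by gcongr
        _ ≤ _ := ENNReal.mul_div_le
    exact (ENNReal.mul_le_mul_iff_right hr' ENNReal.ofReal_ne_top).mp h4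
  have hall : ∀ᵐ x ∂μ, ∀ k : ℕ, ∀ᶠ n in atTop,
      |orbitAvg act (Fs n) f x| ≤ 2 * (1 / ((k : ℝ) + 1)) :=
    ae_all_iff.mpr fun k => key _ (by positivity)
  filter_upwards [hall] with x hx
  rw [Metric.tendsto_atTop']
  intro ε hε
  obtain ⟨k, hk⟩ := exists_nat_one_div_lt (half_pos hε)
  obtain ⟨N, hN⟩ := eventually_atTop.mp (hx k)
  refine ⟨N, fun n hn => ?_⟩
  rw [dist_zero_right, Real.norm_eq_abs]
  have := hN n hn.le
  linarith

/-- Almost every point is generic for an ergodic measure. -/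
theorem ae_mem_genericPoints [DecidableEq G] [Countable G] [IsProbabilityMeasure μ]
    [MetricSpace X] [CompactSpace X] [BorelSpace X] (hact_one : ∀ x, act 1 x = x)
    (hact_mul : ∀ g h x, act (g * h) x = act g (act h x)) (hact_cont : ∀ g, Continuous (act g))
    (hinv : InvariantMeasure act μ) (herg : ErgodicAction act μ) {Fs : ℕ → Finset G}
    (hFol : Folner Fs) (htemp : Tempered Fs) : ∀ᵐ x ∂μ, x ∈ genericPoints act Fs μ := by
  have hmeas : ∀ g, Measurable (act g) := fun g => (hact_cont g).measurable
  have hC : ∀ f : C(X, ℝ), ∃ B, ∀ x, ‖f x‖ ≤ B := fun f => ⟨‖f‖, f.norm_coe_le_norm⟩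
  have hone : ∀ f : C(X, ℝ), ∀ᵐ x ∂μ,
      Tendsto (fun n => orbitAvg act (Fs n) f x) atTop (𝓝 (∫ y, f y ∂μ)) := by
    intro f
    obtain ⟨B, hB⟩ := hC f
    have hfm : Measurable f := f.continuous.measurable
    have hfL : MemLp f ∞ μ := memLp_top_of_bound hfm.aestronglyMeasurable B (ae_of_all _ hB)
    have hfi : Integrable f μ := hfL.integrable le_top
    have := ae_tendsto_orbitAvg_zero hact_one hact_mul hmeas hinv herg hFol htemp
      (f := fun x => f x - ∫ y, f y ∂μ) (hfm.sub_const _)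
      ((hfL.mono_exponent le_top).sub (memLp_const _))
      (by rw [integral_sub hfi (integrable_const _)]; simp)
    filter_upwards [this] with x hx
    have h2 := hx.add_const (∫ y, f y ∂μ)
    rw [zero_add] at h2
    refine h2.congr fun n => ?_
    have hcard : ((Fs n).card : ℝ) ≠ 0 := by exact_mod_cast (hFol.1 n).card_pos.ne'
    simp only [orbitAvg, Finset.sum_sub_distrib, Finset.sum_const, nsmul_eq_mul]
    field_simp
    ring
  obtain ⟨S, hSc, hSd⟩ := TopologicalSpace.exists_countable_dense C(X, ℝ)
  have hall : ∀ᵐ x ∂μ, ∀ f ∈ S,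
      Tendsto (fun n => orbitAvg act (Fs n) f x) atTop (𝓝 (∫ y, f y ∂μ)) :=
    (ae_ball_iff hSc).mpr fun f _ => hone f
  filter_upwards [hall] with x hx f
  rw [Metric.tendsto_atTop]
  intro ε hε
  obtain ⟨f', hf'S, hf'⟩ := hSd.exists_dist_lt f (show 0 < ε / 3 by positivity)
  obtain ⟨N, hN⟩ := Metric.tendsto_atTop.mp (hx f' hf'S) (ε / 3) (by positivity)
  refine ⟨N, fun n hn => ?_⟩
  have hint : ∀ f : C(X, ℝ), Integrable f μ := fun f =>
    Integrable.of_bound f.continuous.measurable.aestronglyMeasurable _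
      (ae_of_all _ (hC f).choose_spec)
  have hpt : ∀ y, |f y - f' y| ≤ dist f f' := fun y => by
    rw [← Real.dist_eq]; exact ContinuousMap.dist_apply_le_dist y
  have h1 : dist (orbitAvg act (Fs n) f x) (orbitAvg act (Fs n) f' x) ≤ dist f f' := by
    have hcard : (0 : ℝ) < (Fs n).card := by exact_mod_cast (hFol.1 n).card_pos
    rw [Real.dist_eq, orbitAvg, orbitAvg, ← sub_div, ← Finset.sum_sub_distrib, abs_div,
      Nat.abs_cast, div_le_iff₀ hcard]
    refine (Finset.abs_sum_le_sum_abs _ _).trans ?_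
    refine (Finset.sum_le_card_nsmul _ _ _ fun g _ => hpt _).trans_eq ?_
    rw [nsmul_eq_mul, mul_comm]
  have h2 : dist (∫ y, f' y ∂μ) (∫ y, f y ∂μ) ≤ dist f f' := by
    rw [dist_comm, Real.dist_eq, ← integral_sub (hint f) (hint f')]
    refine (norm_integral_le_of_norm_le_const (μ := μ) (f := fun y => f y - f' y)
      (ae_of_all _ hpt)).trans_eq ?_
    simp
  have h3 := hN n hn
  have h4 := dist_triangle4 (orbitAvg act (Fs n) f x) (orbitAvg act (Fs n) f' x)
    (∫ y, f' y ∂μ) (∫ y, f y ∂μ)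
  change dist (orbitAvg act (Fs n) f x) _ < ε
  linarith

end Ergodic

/-! ### Finite entropy estimates -/

/-- The Gibbs inequality. -/
lemma sum_negMulLog_le_of_sum_le_one {ι : Type*} [Fintype ι] {p q : ι → ℝ} (hp : ∀ i, 0 ≤ p i)
    (hp1 : ∑ i, p i = 1) (hq : ∀ i, 0 < q i) (hq1 : ∑ i, q i ≤ 1) :
    ∑ i, Real.negMulLog (p i) ≤ ∑ i, p i * -Real.log (q i) := by
  have hpt : ∀ i, Real.negMulLog (p i) ≤ p i * -Real.log (q i) + (q i - p i) := by
    intro i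
    rcases (hp i).eq_or_lt with h | h
    · simp [← h, (hq i).le]
    · have h1 := Real.log_le_sub_one_of_pos (div_pos (hq i) h)
      rw [Real.log_div (hq i).ne' h.ne'] at h1
      have h2 := mul_le_mul_of_nonneg_left h1 h.le
      have h3 : p i * (q i / p i - 1) = q i - p i := by field_simp
      rw [h3] at h2
      rw [Real.negMulLog]
      linarith
  refine (Finset.sum_le_sum fun i _ => hpt i).trans ?_
  rw [Finset.sum_add_distrib, Finset.sum_sub_distrib, hp1]
  linarith

/-- If most of the mass of a probability vector on words lies within small Hamming distance of few
reference words, then its entropy is small. -/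
lemma sum_negMulLog_le_of_hamming {F ι : Type*} [Fintype F] [DecidableEq F] [Fintype ι]
    [DecidableEq ι] [Nonempty ι] {p : (F → ι) → ℝ} (hp : ∀ w, 0 ≤ p w) (hp1 : ∑ w, p w = 1)
    {R : Finset (F → ι)} (hR : R.Nonempty) {Q : Finset (F → ι)} {d β t : ℝ}
    (hQ : ∀ w ∈ Q, ∃ r ∈ R, ((Finset.univ.filter fun g => w g ≠ r g).card : ℝ) ≤ d)
    (hβ : ∑ w ∈ Qᶜ, p w ≤ β) (ht0 : 0 < t) (ht1 : t < 1) (hd : 0 ≤ d) :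
    ∑ w, Real.negMulLog (p w) ≤ Real.log 2 + Real.log R.card + d * Real.log (Fintype.card ι / t) +
      Fintype.card F * -Real.log (1 - t) +
      β * (Real.log 2 + Fintype.card F * Real.log (Fintype.card ι)) := by
  set k : ℝ := (Fintype.card ι : ℝ) with hk
  set m := Fintype.card F with hm
  have hk1 : 1 ≤ k := Nat.one_le_cast.mpr Fintype.card_pos
  have hk0 : 0 < k := by linarith
  have hM1 : (1 : ℝ) ≤ R.card := by exact_mod_cast hR.card_pos
  have hM0 : (0 : ℝ) < R.card := by linarith
  have ht1' : 0 < 1 - t := by linarith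
  have htk : 0 < t / k := by positivity
  have htk1 : t / k ≤ 1 := (div_le_one hk0).mpr (by linarith)
  set π : (F → ι) → (F → ι) → ℝ :=
    fun r w => ∏ g, (t / k + if w g = r g then 1 - t else 0) with hπ
  have hπ0 : ∀ r w, 0 < π r w := fun r w => Finset.prod_pos fun g _ => by split_ifs <;> positivity
  have hπ1 : ∀ r, ∑ w, π r w = 1 := by
    intro r
    have := Finset.prod_univ_sum (fun _ : F => (Finset.univ : Finset ι))
      (fun g i => t / k + if i = r g then 1 - t else 0)
    rw [Fintype.piFinset_univ] at this
    rw [hπ, ← this]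
    refine Finset.prod_eq_one fun g _ => ?_
    rw [Finset.sum_add_distrib, Finset.sum_const, Finset.card_univ, nsmul_eq_mul, ← hk]
    simp
    field_simp
    ring
  set q : (F → ι) → ℝ := fun w => 2⁻¹ * (k ^ m)⁻¹ + 2⁻¹ * ((R.card : ℝ)⁻¹ * ∑ r ∈ R, π r w)
    with hq
  have hq0 : ∀ w, 0 < q w := fun w => by
    have : 0 ≤ ∑ r ∈ R, π r w := Finset.sum_nonneg fun r _ => (hπ0 r w).le
    positivity
  have hq1 : ∑ w, q w = 1 := by
    rw [hq, Finset.sum_add_distrib, ← Finset.mul_sum, ← Finset.mul_sum, ← Finset.mul_sum,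
      Finset.sum_comm, Finset.sum_congr rfl fun r _ => hπ1 r]
    simp only [Finset.sum_const, Finset.card_univ, Fintype.card_fun, nsmul_eq_mul, mul_one]
    push_cast
    rw [← hk, ← hm, inv_mul_cancel₀ hM0.ne']
    field_simp
    norm_num
  set a : ℝ := Real.log 2 + Real.log R.card + d * Real.log (k / t) + m * -Real.log (1 - t) with ha
  set b : ℝ := Real.log 2 + m * Real.log k with hb
  have hlogtk : Real.log (k / t) = -Real.log (t / k) := by rw [← Real.log_inv, inv_div]
  have hlogtk0 : 0 ≤ Real.log (k / t) := Real.log_nonneg ((one_le_div ht0).mpr (by linarith))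
  have hlogt : 0 ≤ -Real.log (1 - t) := by
    rw [neg_nonneg]; exact Real.log_nonpos ht1'.le (by linarith)
  have hlogM : 0 ≤ Real.log R.card := Real.log_nonneg hM1
  have hlogk : 0 ≤ Real.log k := Real.log_nonneg hk1
  have hlog2 : 0 ≤ Real.log 2 := Real.log_nonneg one_le_two
  have ha0 : 0 ≤ a := by positivity
  have hb0 : 0 ≤ b := by positivity
  have hbad : ∀ w, -Real.log (q w) ≤ b := by
    intro w
    have h1 : 2⁻¹ * (k ^ m)⁻¹ ≤ q w := by
      have : 0 ≤ ∑ r ∈ R, π r w := Finset.sum_nonneg fun r _ => (hπ0 r w).le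
      have : 0 ≤ 2⁻¹ * ((R.card : ℝ)⁻¹ * ∑ r ∈ R, π r w) := by positivity
      simp only [hq]; linarith
    have h2 := Real.log_le_log (by positivity) h1
    rw [Real.log_mul (by positivity) (by positivity), Real.log_inv, Real.log_inv,
      Real.log_pow] at h2
    linarith
  have hgood : ∀ w ∈ Q, -Real.log (q w) ≤ a := by
    intro w hw
    obtain ⟨r, hr, hdr⟩ := hQ w hw
    set e := (Finset.univ.filter fun g => w g ≠ r g).card with he
    have h1 : (1 - t) ^ m * (t / k) ^ e ≤ π r w := by
      calc (1 - t) ^ m * (t / k) ^ e = ∏ g, ((1 - t) * if w g ≠ r g then t / k else 1) := by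
            rw [Finset.prod_mul_distrib, Finset.prod_const, Finset.card_univ, ← hm,
              Finset.prod_ite, Finset.prod_const, Finset.prod_const_one, mul_one]
        _ ≤ π r w := by
            refine Finset.prod_le_prod (fun g _ => by split_ifs <;> positivity) fun g _ => ?_
            by_cases h : w g = r g
            · simp [h, htk.le]
            · simp only [ne_eq, h, not_false_eq_true, if_true, if_false, add_zero]
              nlinarith
    have h2 : 2⁻¹ * ((R.card : ℝ)⁻¹ * ((1 - t) ^ m * (t / k) ^ e)) ≤ q w := by
      have h3 : π r w ≤ ∑ r ∈ R, π r w :=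
        Finset.single_le_sum (f := fun r => π r w) (fun r _ => (hπ0 r w).le) hr
      have h4 : 2⁻¹ * ((R.card : ℝ)⁻¹ * ((1 - t) ^ m * (t / k) ^ e)) ≤
          2⁻¹ * ((R.card : ℝ)⁻¹ * ∑ r ∈ R, π r w) := by
        gcongr
        exact h1.trans h3
      have : 0 < 2⁻¹ * (k ^ m)⁻¹ := by positivity
      simp only [hq]; linarith
    have h5 := Real.log_le_log (by positivity) h2
    rw [Real.log_mul (by positivity) (by positivity), Real.log_mul (by positivity) (by positivity),
      Real.log_mul (by positivity) (by positivity), Real.log_inv, Real.log_inv, Real.log_pow,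
      Real.log_pow] at h5
    have h6 : (e : ℝ) * Real.log (k / t) ≤ d * Real.log (k / t) := by gcongr
    rw [hlogtk] at h6
    rw [ha, hlogtk]
    linarith
  calc ∑ w, Real.negMulLog (p w) ≤ ∑ w, p w * -Real.log (q w) :=
        sum_negMulLog_le_of_sum_le_one hp hp1 hq0 hq1.le
    _ ≤ ∑ w, (p w * a + if w ∈ Q then 0 else p w * b) := by
        refine Finset.sum_le_sum fun w _ => ?_
        split_ifs with hw
        · rw [add_zero]
          exact mul_le_mul_of_nonneg_left (hgood w hw) (hp w)
        · rw [← mul_add]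
          exact mul_le_mul_of_nonneg_left ((hbad w).trans (by linarith)) (hp w)
    _ = a + (∑ w ∈ Qᶜ, p w) * b := by
        rw [Finset.sum_add_distrib, ← Finset.sum_mul, hp1, one_mul, Finset.sum_mul]
        congr 1
        rw [Finset.sum_ite, Finset.sum_const_zero, zero_add]
        refine Finset.sum_congr ?_ fun _ _ => rfl
        ext w
        simp
    _ ≤ a + β * b := by gcongr

/-! ### Separated sets and packings -/

lemma exists_maximal_pairwise (r : X → X → Prop) (hr : ∀ x y, r x y → r y x) (Γ : Set X) (B : ℕ)
    (hB : ∀ E : Finset X, ↑E ⊆ Γ → (E : Set X).Pairwise r → E.card ≤ B) :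
    ∃ E : Finset X, ↑E ⊆ Γ ∧ (E : Set X).Pairwise r ∧ ∀ y ∈ Γ, ∃ x ∈ E, x = y ∨ ¬ r x y := by
  classical
  set T : Set ℕ := {n | ∃ E : Finset X, ↑E ⊆ Γ ∧ (E : Set X).Pairwise r ∧ E.card = n} with hT
  have hTne : T.Nonempty := ⟨0, ∅, by simp, by simp, rfl⟩
  have hTb : BddAbove T := ⟨B, by rintro n ⟨E, h1, h2, rfl⟩; exact hB E h1 h2⟩
  obtain ⟨E, h1, h2, h3⟩ := Nat.sSup_mem hTne hTb
  refine ⟨E, h1, h2, fun y hy => ?_⟩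
  by_contra! hcon
  have hyE : y ∉ E := fun h => (hcon y h).1 rfl
  have hmem : E.card + 1 ∈ T := by
    refine ⟨insert y E, ?_, ?_, Finset.card_insert_of_notMem hyE⟩
    · rw [Finset.coe_insert]
      exact insert_subset hy h1
    · rw [Finset.coe_insert, pairwise_insert]
      exact ⟨h2, fun x hx _ => ⟨hr _ _ (hcon x hx).2, (hcon x hx).2⟩⟩
  have := le_csSup hTb hmem
  omega

section Balls

variable [MetricSpace X] {act : G → X → X}

lemma mem_dynBall_self (F : Finset G) (x : X) {ε : ℝ} (hε : 0 < ε) : x ∈ dynBall act F x ε :=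
  fun g _ => by simpa using hε

lemma mem_dynClosedBall_self (F : Finset G) (x : X) {ε : ℝ} (hε : 0 ≤ ε) :
    x ∈ dynClosedBall act F x ε :=
  fun g _ => by simpa using hε

lemma isOpen_dynBall (hact_cont : ∀ g, Continuous (act g)) (F : Finset G) (x : X) (ε : ℝ) :
    IsOpen (dynBall act F x ε) := by
  have : dynBall act F x ε = ⋂ g ∈ F, {y | dist (act g x) (act g y) < ε} := by
    ext; simp [dynBall]
  rw [this]
  exact isOpen_biInter_finset fun g _ =>
    isOpen_lt (continuous_const.dist (hact_cont g)) continuous_const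

/-- Finite families of disjoint closed balls over the same set bound the packing pre-measure from
below. -/
lemma card_mul_le_packP {Fs : ℕ → Finset G} {Z : Set X} {N n : ℕ} (hn : N ≤ n) {ε s : ℝ}
    {E : Finset X} (hE : ↑E ⊆ Z)
    (hd : (E : Set X).Pairwise fun x y =>
      Disjoint (dynClosedBall act (Fs n) x ε) (dynClosedBall act (Fs n) y ε)) :
    (E.card : ℝ≥0∞) * ENNReal.ofReal (Real.exp (-s * ((Fs n).card : ℝ))) ≤
      packP act Fs Z N ε s := by
  rcases E.eq_empty_or_nonempty with rfl | ⟨x₀, hx₀⟩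
  · simp
  set t : Set ℕ := {i | i < E.card} with ht
  set c : ℕ → X × ℕ := fun i => (if h : i < E.card then (E.equivFin.symm ⟨i, h⟩ : X) else x₀, n)
    with hc
  have hc1 : ∀ i, (c i).1 ∈ E := by
    intro i
    simp only [hc]
    split_ifs
    · exact Subtype.prop _
    · exact hx₀
  have h1 : ∀ i ∈ t, (c i).1 ∈ Z ∧ N ≤ (c i).2 := fun i _ => ⟨hE (hc1 i), hn⟩
  have h2 : ∀ i ∈ t, ∀ j ∈ t, i ≠ j → Disjoint (dynClosedBall act (Fs (c i).2) (c i).1 ε)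
      (dynClosedBall act (Fs (c j).2) (c j).1 ε) := by
    intro i hi j hj hij
    refine hd (hc1 i) (hc1 j) fun heq => hij ?_
    simp only [hc, dif_pos (show i < E.card from hi), dif_pos (show j < E.card from hj)] at heq
    simpa using E.equivFin.symm.injective (Subtype.ext heq)
  unfold packP
  refine le_iSup_of_le t (le_iSup_of_le c (le_iSup_of_le h1 (le_iSup_of_le h2 ?_)))
  simp only [hc]
  rw [ENNReal.tsum_set_const]
  have : t.encard = E.card := by
    rw [show t = ↑(Finset.range E.card) by ext; simp [ht], Set.encard_coe_eq_coe_finsetCard,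
      Finset.card_range]
  rw [this]
  simp

end Balls

/-! ### Lower bound: local lower bounds on the measure of balls control partition entropy -/

section Lower

variable [MeasurableSpace X] {act : G → X → X} {μ : Measure X} [IsProbabilityMeasure μ]

open scoped Classical in
/-- The Markov inequality for the number of visits to a small set. -/
lemma measureReal_compl_few_visits_le (hact_meas : ∀ g, Measurable (act g))
    (hinv : InvariantMeasure act μ) {F : Finset G} (hF : F.Nonempty) {U : Set X}
    (hU : MeasurableSet U) {θ : ℝ} (hθ : 0 < θ) :
    μ.real {x | (((Finset.univ : Finset F).filter fun g : F => act g x ∈ U).card : ℝ) ≤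
      θ * F.card}ᶜ ≤ μ.real U / θ := by
  set f : X → ℝ := fun x => ∑ g : F, (act g ⁻¹' U).indicator (fun _ => (1 : ℝ)) x with hf
  have hfc : ∀ x, (((Finset.univ : Finset F).filter fun g : F => act g x ∈ U).card : ℝ) = f x := by
    intro x
    rw [hf, Finset.card_filter]
    push_cast
    exact Finset.sum_congr rfl fun g _ => by simp [indicator_apply]
  have hpre : ∀ g : F, MeasurableSet (act g ⁻¹' U) := fun g => hact_meas g hU
  have hint : ∀ g ∈ (Finset.univ : Finset F),
      Integrable ((act g ⁻¹' U).indicator fun _ => (1 : ℝ)) μ :=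
    fun g _ => (integrable_const 1).indicator (hpre g)
  have hfint : Integrable f μ := integrable_finsetSum _ hint
  have hfi : ∫ x, f x ∂μ = F.card * μ.real U := by
    rw [hf, integral_finsetSum _ hint]
    have : ∀ g : F, ∫ x, (act g ⁻¹' U).indicator (fun _ => (1 : ℝ)) x ∂μ = μ.real U := by
      intro g
      rw [integral_indicator_const _ (hpre g), smul_eq_mul, mul_one, Measure.real, hinv g U hU]
      rfl
    simp [this]
  have hF0 : (0 : ℝ) < F.card := by exact_mod_cast hF.card_pos
  have hmk := mul_meas_ge_le_integral_of_nonneg (μ := μ) (f := f)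
    (ae_of_all _ fun x => Finset.sum_nonneg fun g _ => indicator_nonneg (fun _ _ => zero_le_one) x)
    hfint (θ * F.card)
  have hsub : μ.real {x | (((Finset.univ : Finset F).filter fun g : F => act g x ∈ U).card : ℝ) ≤
      θ * F.card}ᶜ ≤ μ.real {x | θ * F.card ≤ f x} := by
    refine measureReal_mono fun x hx => ?_
    simp only [mem_compl_iff, mem_ofPred_eq, not_le] at hx ⊢
    rw [← hfc]
    exact hx.le
  rw [le_div_iff₀ hθ]
  rw [hfi] at hmk
  have h1 : (μ.real {x | θ * F.card ≤ f x} * θ) * F.card ≤ μ.real U * F.card := by linarith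
  exact (mul_le_mul_of_nonneg_right hsub hθ.le).trans (le_of_mul_le_mul_right h1 hF0)

variable [MetricSpace X] [BorelSpace X]

open scoped Classical in
/-- If most points have dynamical balls of measure at least `c`, then the entropy of a partition
whose cells are separated away from a small set is at most about `-log c`. -/
lemma partEnt_le_of_measure_dynBall_ge [DecidableEq G] {ι : Type*} [Fintype ι] [Nonempty ι]
    (hact_cont : ∀ g, Continuous (act g))
    (hinv : InvariantMeasure act μ) {F : Finset G} (hF : F.Nonempty) [MeasurableSpace ι]
    [MeasurableSingletonClass ι] {P : X → ι} (hP : Measurable P)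
    {U : Set X} (hU : MeasurableSet U) {ε : ℝ} (hε : 0 < ε)
    (hsep : ∀ x ∉ U, ∀ y ∉ U, dist x y < 4 * ε → P x = P y) {Γ : Set X} {c : ℝ} (hc : 0 < c)
    (hΓ : ∀ x ∈ Γ, ENNReal.ofReal c ≤ μ (dynBall act F x ε)) {η θ t κ : ℝ}
    (hη : 1 - η ≤ μ.real Γ) (hκ : μ.real U ≤ κ) (hθ : 0 < θ)
    (ht0 : 0 < t) (ht1 : t < 1) (hlt : η + κ / θ < 1) :
    partEnt μ (fun x (g : F) => P (act g x)) ≤ Real.log 2 + -Real.log c +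
      2 * θ * F.card * Real.log (Fintype.card ι / t) + F.card * -Real.log (1 - t) +
      (η + κ / θ) * (Real.log 2 + F.card * Real.log (Fintype.card ι)) := by
  have hact_meas : ∀ g, Measurable (act g) := fun g => (hact_cont g).measurable
  set name : X → (F → ι) := fun x g => P (act g x) with hname
  have hname_meas : Measurable name :=
    measurable_pi_lambda _ fun g => hP.comp (hact_meas g)
  have hopen := fun x r => isOpen_dynBall hact_cont F x r
  -- disjoint balls centred in `Γ`
  have hcard : ∀ E : Finset X, ↑E ⊆ Γ →
      (E : Set X).Pairwise (fun x y => Disjoint (dynBall act F x ε) (dynBall act F y ε)) →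
      (E.card : ℝ) ≤ 1 / c := by
    intro E hE hd
    have h1 : ∑ x ∈ E, ENNReal.ofReal c ≤ 1 :=
      calc ∑ x ∈ E, ENNReal.ofReal c ≤ ∑ x ∈ E, μ (dynBall act F x ε) :=
            Finset.sum_le_sum fun x hx => hΓ x (hE hx)
        _ = μ (⋃ x ∈ E, dynBall act F x ε) :=
            (measure_biUnion_finset hd fun x _ => (hopen x ε).measurableSet).symm
        _ ≤ 1 := prob_le_one
    rw [Finset.sum_const, nsmul_eq_mul, ← ENNReal.ofReal_natCast, ← ENNReal.ofReal_mul
      (Nat.cast_nonneg _), ENNReal.ofReal_le_one] at h1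
    exact (le_div_iff₀ hc).mpr h1
  obtain ⟨E, hEΓ, hEd, hEmax⟩ := exists_maximal_pairwise
    (fun x y => Disjoint (dynBall act F x ε) (dynBall act F y ε)) (fun _ _ h => h.symm) Γ
    ⌊1 / c⌋₊ fun E h1 h2 => Nat.le_floor (hcard E h1 h2)
  have hEc := hcard E hEΓ hEd
  set C : Set X := ⋃ x ∈ E, dynBall act F x (2 * ε) with hC
  have hCmeas : MeasurableSet C :=
    Finset.measurableSet_biUnion _ fun x _ => (hopen x _).measurableSet
  have hΓC : Γ ⊆ C := by
    intro y hy
    obtain ⟨x, hxE, hx⟩ := hEmax y hy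
    refine mem_biUnion hxE ?_
    rcases hx with rfl | hx
    · exact mem_dynBall_self F x (by positivity)
    · obtain ⟨z, hz1, hz2⟩ := not_disjoint_iff.mp hx
      intro g hg
      have h1 := hz1 g hg
      have h2 := hz2 g hg
      have h3 := dist_triangle_right (act g x) (act g y) (act g z)
      linarith
  set V : Set X := {x | (((Finset.univ : Finset F).filter fun g : F => act g x ∈ U).card : ℝ) ≤
      θ * F.card} with hV
  have hVc : μ.real Vᶜ ≤ κ / θ :=
    (measureReal_compl_few_visits_le hact_meas hinv hF hU hθ).trans (by gcongr)
  have hCc : μ.real Cᶜ ≤ η := by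
    rw [probReal_compl_eq_one_sub hCmeas]
    have := measureReal_mono (μ := μ) hΓC (measure_ne_top _ _)
    linarith
  have hCV : μ.real (C ∩ V)ᶜ ≤ η + κ / θ := by
    rw [compl_inter]
    exact (measureReal_union_le _ _).trans (add_le_add hCc hVc)
  set rep : X → X := fun e =>
    if h : (dynBall act F e (2 * ε) ∩ V).Nonempty then h.some else e with hrep
  have hrep_mem : ∀ e, (dynBall act F e (2 * ε) ∩ V).Nonempty →
      rep e ∈ dynBall act F e (2 * ε) ∩ V := by
    intro e he
    simp only [hrep, dif_pos he]
    exact he.some_mem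
  set R : Finset (F → ι) := (E.filter fun e => (dynBall act F e (2 * ε) ∩ V).Nonempty).image
    fun e => name (rep e) with hR
  set Q : Finset (F → ι) := Finset.univ.filter fun w => ∃ x ∈ C ∩ V, name x = w with hQ
  have hRne : R.Nonempty := by
    have : (C ∩ V).Nonempty := by
      by_contra hcon
      rw [not_nonempty_iff_eq_empty] at hcon
      rw [hcon, compl_empty, probReal_univ] at hCV
      linarith
    obtain ⟨y, hyC, hyV⟩ := this
    obtain ⟨e, he, hye⟩ := mem_iUnion₂.mp hyC
    exact ⟨_, Finset.mem_image.mpr ⟨e, Finset.mem_filter.mpr ⟨he, y, hye, hyV⟩, rfl⟩⟩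
  have hRc : Real.log R.card ≤ -Real.log c := by
    rw [← Real.log_inv, ← one_div]
    refine Real.log_le_log (by exact_mod_cast hRne.card_pos) (le_trans ?_ hEc)
    exact_mod_cast Finset.card_image_le.trans (Finset.card_filter_le _ _)
  have hQR : ∀ w ∈ Q, ∃ r ∈ R,
      ((Finset.univ.filter fun g => w g ≠ r g).card : ℝ) ≤ 2 * θ * F.card := by
    intro w hw
    obtain ⟨y, ⟨hyC, hyV⟩, rfl⟩ := (Finset.mem_filter.mp hw).2
    obtain ⟨e, he, hye⟩ := mem_iUnion₂.mp hyC
    have hne : (dynBall act F e (2 * ε) ∩ V).Nonempty := ⟨y, hye, hyV⟩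
    obtain ⟨hx1, hx2⟩ := hrep_mem e hne
    refine ⟨name (rep e), Finset.mem_image.mpr ⟨e, Finset.mem_filter.mpr ⟨he, hne⟩, rfl⟩, ?_⟩
    have hsub : (Finset.univ.filter fun g => name y g ≠ name (rep e) g) ⊆
        ((Finset.univ : Finset F).filter fun g : F => act g y ∈ U) ∪
          ((Finset.univ : Finset F).filter fun g : F => act g (rep e) ∈ U) := by
      intro g hg
      rw [Finset.mem_filter] at hg
      by_contra hcon
      simp only [Finset.mem_union, Finset.mem_filter, Finset.mem_univ, true_and, not_or] at hcon
      refine hg.2 (hsep _ hcon.1 _ hcon.2 ?_)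
      have h1 := hye g g.2
      have h2 := hx1 g g.2
      have h3 := dist_triangle_left (act g y) (act g (rep e)) (act g e)
      linarith
    have h1 := (Finset.card_le_card hsub).trans (Finset.card_union_le _ _)
    have h2 : ((Finset.univ.filter fun g => name y g ≠ name (rep e) g).card : ℝ) ≤
        ((Finset.univ : Finset F).filter fun g : F => act g y ∈ U).card +
          ((Finset.univ : Finset F).filter fun g : F => act g (rep e) ∈ U).card := by
      exact_mod_cast h1
    rw [hV, mem_ofPred_eq] at hyV hx2
    linarith
  have hsum : ∀ S : Finset (F → ι), ∑ w ∈ S, μ.real (name ⁻¹' {w}) = μ.real (name ⁻¹' ↑S) :=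
    fun S => sum_measureReal_preimage_singleton S fun w _ =>
      hname_meas (measurableSet_singleton w)
  have hp1 : ∑ w, μ.real (name ⁻¹' {w}) = 1 := by
    rw [hsum, Finset.coe_univ, preimage_univ, probReal_univ]
  have hβ : ∑ w ∈ Qᶜ, μ.real (name ⁻¹' {w}) ≤ η + κ / θ := by
    rw [hsum]
    refine (measureReal_mono fun x hx hxCV => ?_).trans hCV
    rw [mem_preimage, Finset.mem_coe, Finset.mem_compl] at hx
    exact hx (Finset.mem_filter.mpr ⟨Finset.mem_univ _, x, hxCV, rfl⟩)
  have key := sum_negMulLog_le_of_hamming (fun w => measureReal_nonneg) hp1 hRne hQR hβ ht0 ht1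
    (by positivity)
  rw [Fintype.card_coe] at key
  unfold partEnt
  refine (le_of_eq ?_).trans (key.trans ?_)
  · rfl
  · gcongr

lemma exists_not_ae_le_measure_dynBall [DecidableEq G] [CompactSpace X]
    (hact_cont : ∀ g, Continuous (act g))
    (hinv : InvariantMeasure act μ) {Fs : ℕ → Finset G} (hne : ∀ n, (Fs n).Nonempty)
    (hcard : Tendsto (fun n => ((Fs n).card : ℝ)) atTop atTop) {k : ℕ} {P : X → Fin k}
    (hP : Measurable P) {s s₂ : ℝ} (hs : s < s₂)
    (hfreq : ∃ᶠ n in atTop, s₂ * (Fs n).card < partEnt μ fun x (g : Fs n) => P (act g x)) :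
    ∃ ε : ℝ, 0 < ε ∧ ¬ ∀ᵐ x ∂μ, ∀ᶠ n in atTop,
      ENNReal.ofReal (Real.exp (-s * (Fs n).card)) ≤ μ (dynBall act (Fs n) x ε) := by
  have hX : Nonempty X := nonempty_of_isProbabilityMeasure μ
  have hk : Nonempty (Fin k) := hX.map P
  have hk1 : (1 : ℝ) ≤ k := by
    have : 0 < k := Fin.pos_iff_nonempty.mpr hk
    exact_mod_cast this
  obtain ⟨δ, hδ⟩ : ∃ δ, δ = (s₂ - s) / 4 := ⟨_, rfl⟩
  have hδ0 : 0 < δ := by rw [hδ]; linarith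
  obtain ⟨t, ht⟩ : ∃ t, t = 1 - Real.exp (-δ) := ⟨_, rfl⟩
  have ht0 : 0 < t := by
    have : Real.exp (-δ) < 1 := Real.exp_lt_one_iff.mpr (by linarith)
    linarith
  have ht1 : t < 1 := by have := Real.exp_pos (-δ); linarith
  have hlt : -Real.log (1 - t) = δ := by rw [ht, _root_.sub_sub_cancel, Real.log_exp, neg_neg]
  have hL0 : 0 ≤ Real.log (k / t) := Real.log_nonneg ((one_le_div ht0).mpr (by linarith))
  have hk0 : 0 ≤ Real.log k := Real.log_nonneg hk1
  obtain ⟨θ, hθ⟩ : ∃ θ, θ = δ / (2 * Real.log (k / t) + 1) := ⟨_, rfl⟩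
  have hθ0 : 0 < θ := by rw [hθ]; positivity
  have hθL : 2 * θ * Real.log (k / t) ≤ δ := by
    have : θ * (2 * Real.log (k / t) + 1) = δ := by rw [hθ]; field_simp
    linarith
  obtain ⟨γ, hγ⟩ : ∃ γ, γ = min (1 / 2) (δ / (Real.log k + 1)) := ⟨_, rfl⟩
  have hγ0 : 0 < γ := by rw [hγ]; positivity
  have hγ1 : γ ≤ 1 / 2 := by rw [hγ]; exact min_le_left _ _
  have hγk : γ * Real.log k ≤ δ := by
    have h1 : γ ≤ δ / (Real.log k + 1) := by rw [hγ]; exact min_le_right _ _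
    rw [le_div_iff₀ (by positivity)] at h1
    linarith
  -- closed cells
  have hcl : ∀ i : Fin k, ∃ K ⊆ P ⁻¹' {i}, IsClosed K ∧
      μ (P ⁻¹' {i} \ K) < ENNReal.ofReal (θ * γ / 2 / k) := fun i =>
    (hP (measurableSet_singleton i)).exists_isClosed_sdiff_lt (measure_ne_top _ _)
      (by rw [ne_eq, ENNReal.ofReal_eq_zero, not_le]; positivity)
  choose K hKsub hKcl hKμ using hcl
  set U : Set X := (⋃ i, K i)ᶜ with hU
  have hUmeas : MeasurableSet U :=
    (MeasurableSet.iUnion fun i => (hKcl i).measurableSet).compl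
  have hUκ : μ.real U ≤ θ * γ / 2 := by
    have h1 : U ⊆ ⋃ i, P ⁻¹' {i} \ K i := fun x hx =>
      mem_iUnion.mpr ⟨P x, rfl, fun h => hx (mem_iUnion.mpr ⟨_, h⟩)⟩
    calc μ.real U ≤ μ.real (⋃ i, P ⁻¹' {i} \ K i) := measureReal_mono h1 (measure_ne_top _ _)
      _ ≤ ∑ i, μ.real (P ⁻¹' {i} \ K i) := measureReal_iUnion_fintype_le _
      _ ≤ ∑ _i : Fin k, θ * γ / 2 / k := Finset.sum_le_sum fun i _ =>
          ENNReal.toReal_le_of_le_ofReal (by positivity) (hKμ i).le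
      _ = θ * γ / 2 := by
          rw [Finset.sum_const, Finset.card_univ, Fintype.card_fin, nsmul_eq_mul]
          field_simp
  have hdist : ∀ᶠ r in 𝓝[>] (0 : ℝ), ∀ i j : Fin k, i ≠ j → ∀ x ∈ K i, ∀ y ∈ K j,
      r < dist x y := by
    rw [eventually_all]
    intro i
    rw [eventually_all]
    intro j
    by_cases hij : i = j
    · exact Eventually.of_forall fun r h => absurd hij h
    have hdisj : Disjoint (K i) (K j) :=
      Disjoint.mono (hKsub i) (hKsub j) (Disjoint.preimage P (by simpa using hij))
    obtain ⟨r₀, hr₀, hr⟩ := Metric.exists_pos_forall_lt_edist (hKcl i).isCompact (hKcl j) hdisj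
    filter_upwards [Ioc_mem_nhdsGT (show (0 : ℝ) < r₀ from hr₀)] with r hr' _ x hx y hy
    have h1 := hr x hx y hy
    rw [edist_nndist, ENNReal.coe_lt_coe] at h1
    exact hr'.2.trans_lt (by exact_mod_cast h1)
  obtain ⟨r, hr, hr0⟩ := (hdist.and self_mem_nhdsWithin).exists
  refine ⟨r / 4, by positivity, fun hae => ?_⟩
  have hsep : ∀ x ∉ U, ∀ y ∉ U, dist x y < 4 * (r / 4) → P x = P y := by
    intro x hx y hy hxy
    obtain ⟨i, hi⟩ := mem_iUnion.mp (notMem_compl_iff.mp hx)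
    obtain ⟨j, hj⟩ := mem_iUnion.mp (notMem_compl_iff.mp hy)
    have h1 : P x = i := hKsub i hi
    have h2 : P y = j := hKsub j hj
    rw [h1, h2]
    by_contra hij
    have := hr i j hij x hi y hj
    linarith
  set good : ℕ → Set X := fun n => {x | ∀ m ≥ n,
    ENNReal.ofReal (Real.exp (-s * (Fs m).card)) ≤ μ (dynBall act (Fs m) x (r / 4))} with hgood
  have hmono : Monotone good := fun a b hab x hx m hm => hx m (hab.trans hm)
  have hfull : μ (⋃ n, good n) = 1 := by
    rw [← measure_univ (μ := μ)]
    refine measure_congr (eventuallyEq_univ.mpr ?_)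
    filter_upwards [hae] with x hx
    obtain ⟨n, hn⟩ := eventually_atTop.mp hx
    exact mem_iUnion.mpr ⟨n, hn⟩
  have hlim := tendsto_measure_iUnion_atTop (μ := μ) hmono
  rw [hfull] at hlim
  have hev1 : ∀ᶠ n in atTop, ENNReal.ofReal (1 - γ / 2) < (μ ∘ good) n :=
    hlim.eventually_const_lt (by rw [ENNReal.ofReal_lt_one]; linarith)
  have hev2 : ∀ᶠ n in atTop, 2 * Real.log 2 / δ < ((Fs n).card : ℝ) :=
    hcard.eventually_gt_atTop _
  obtain ⟨n, hn, hn1, hn2⟩ := (hfreq.and_eventually (hev1.and hev2)).exists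
  have hη : 1 - γ / 2 ≤ μ.real (good n) :=
    (ENNReal.ofReal_le_iff_le_toReal (measure_ne_top _ _)).mp hn1.le
  have hsum : γ / 2 + θ * γ / 2 / θ = γ := by field_simp; ring
  have key := partEnt_le_of_measure_dynBall_ge hact_cont hinv (hne n) hP hUmeas
    (show 0 < r / 4 by positivity) hsep (Real.exp_pos (-s * (Fs n).card))
    (Γ := good n) (fun x hx => hx n le_rfl) hη hUκ hθ0 ht0 ht1 (by rw [hsum]; linarith)
  rw [hsum, Real.log_exp, hlt, Fintype.card_fin] at key
  rw [div_lt_iff₀ hδ0] at hn2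
  have hm0 : (0 : ℝ) ≤ (Fs n).card := Nat.cast_nonneg _
  have h1 := mul_le_mul_of_nonneg_left hθL hm0
  have h2 := mul_le_mul_of_nonneg_left hγk hm0
  have h3 : γ * Real.log 2 ≤ 1 * Real.log 2 :=
    mul_le_mul_of_nonneg_right (by linarith) (Real.log_nonneg one_le_two)
  have h4 : s₂ = s + 4 * δ := by rw [hδ]; ring
  rw [h4] at hn
  nlinarith

end Lower

section LowerPacking

variable [MetricSpace X] [MeasurableSpace X] {act : G → X → X} {μ : Measure X}
  {Fs : ℕ → Finset G}

lemma measure_setOf_lt_le_of_packP_lt_one {Z : Set X} {N n : ℕ} (hn : N ≤ n) {ε s s' : ℝ}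
    (hε : 0 < ε) (hpack : packP act Fs Z N (ε / 3) s' < 1) :
    μ {x ∈ Z | μ (dynBall act (Fs n) x ε) < ENNReal.ofReal (Real.exp (-s * (Fs n).card))} ≤
      ENNReal.ofReal (Real.exp (-(s - s') * (Fs n).card)) := by
  set Γ : Set X := {x ∈ Z | μ (dynBall act (Fs n) x ε) <
    ENNReal.ofReal (Real.exp (-s * (Fs n).card))} with hΓ
  have hcard : ∀ E : Finset X, ↑E ⊆ Γ → (E : Set X).Pairwise (fun x y =>
      Disjoint (dynClosedBall act (Fs n) x (ε / 3)) (dynClosedBall act (Fs n) y (ε / 3))) →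
      (E.card : ℝ) ≤ Real.exp (s' * (Fs n).card) := by
    intro E hE hd
    have h1 := (card_mul_le_packP hn (fun x hx => (hE hx).1) hd (s := s')).trans hpack.le
    rw [← ENNReal.ofReal_natCast, ← ENNReal.ofReal_mul (Nat.cast_nonneg _),
      ENNReal.ofReal_le_one, neg_mul, Real.exp_neg, ← div_eq_mul_inv,
      div_le_one (Real.exp_pos _)] at h1
    exact h1
  obtain ⟨E, hEΓ, hEd, hEmax⟩ := exists_maximal_pairwise
    (fun x y => Disjoint (dynClosedBall act (Fs n) x (ε / 3)) (dynClosedBall act (Fs n) y (ε / 3)))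
    (fun _ _ h => h.symm) Γ _ fun E h1 h2 => Nat.le_floor (hcard E h1 h2)
  have hsub : Γ ⊆ ⋃ x ∈ E, dynBall act (Fs n) x ε := by
    intro y hy
    obtain ⟨x, hxE, hx⟩ := hEmax y hy
    refine mem_biUnion hxE ?_
    rcases hx with rfl | hx
    · exact mem_dynBall_self _ x hε
    · obtain ⟨z, hz1, hz2⟩ := not_disjoint_iff.mp hx
      intro g hg
      have h1 := hz1 g hg
      have h2 := hz2 g hg
      have h3 := dist_triangle_right (act g x) (act g y) (act g z)
      linarith
  calc μ Γ ≤ ∑ x ∈ E, μ (dynBall act (Fs n) x ε) :=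
        (measure_mono hsub).trans (measure_biUnion_finset_le _ _)
    _ ≤ ∑ _x ∈ E, ENNReal.ofReal (Real.exp (-s * (Fs n).card)) :=
        Finset.sum_le_sum fun x hx => (hEΓ hx).2.le
    _ = ENNReal.ofReal (E.card * Real.exp (-s * (Fs n).card)) := by
        rw [Finset.sum_const, nsmul_eq_mul, ENNReal.ofReal_mul (Nat.cast_nonneg _),
          ENNReal.ofReal_natCast]
    _ ≤ ENNReal.ofReal (Real.exp (s' * (Fs n).card) * Real.exp (-s * (Fs n).card)) := by
        have := hcard E hEΓ hEd
        gcongr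
    _ = _ := by rw [← Real.exp_add]; ring_nf

variable [Group G]

/-- A set of full measure has positive packing outer measure as soon as dynamical balls are
infinitely often small on a set of positive measure. -/
lemma packOuter_ne_zero (hgrow : GrowthCond Fs) {Z : Set X} (hZ : ∀ᵐ x ∂μ, x ∈ Z) {ε s s' : ℝ}
    (hε : 0 < ε) (hs : s' < s)
    (hA : ¬ ∀ᵐ x ∂μ, ∀ᶠ n in atTop,
      ENNReal.ofReal (Real.exp (-s * (Fs n).card)) ≤ μ (dynBall act (Fs n) x ε)) :
    packOuter act Fs Z (ε / 3) s' ≠ 0 := by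
  intro h0
  have h1 : packOuter act Fs Z (ε / 3) s' < 1 := by rw [h0]; exact zero_lt_one
  simp only [packOuter, iInf_lt_iff] at h1
  obtain ⟨Zs, hcov, hsum⟩ := h1
  refine hA ?_
  have hnull : ∀ i, ∀ᵐ x ∂μ, x ∈ Zs i → ∀ᶠ n in atTop,
      ENNReal.ofReal (Real.exp (-s * (Fs n).card)) ≤ μ (dynBall act (Fs n) x ε) := by
    intro i
    have h2 : packPLim act Fs (Zs i) (ε / 3) s' < 1 := (ENNReal.le_tsum i).trans_lt hsum
    simp only [packPLim, iInf_lt_iff] at h2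
    obtain ⟨N, hN⟩ := h2
    set S : ℕ → Set X := fun n => {x | N ≤ n ∧ x ∈ Zs i ∧
      μ (dynBall act (Fs n) x ε) < ENNReal.ofReal (Real.exp (-s * (Fs n).card))} with hS
    have hSμ : ∀ n, μ (S n) ≤ ENNReal.ofReal (Real.exp (-(s - s') * (Fs n).card)) := by
      intro n
      by_cases hn : N ≤ n
      · exact (measure_mono fun x hx => hx.2).trans
          (measure_setOf_lt_le_of_packP_lt_one hn hε hN)
      · have : S n = ∅ := eq_empty_of_forall_notMem fun x hx => hn hx.1
        rw [this, measure_empty]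
        exact zero_le
    have hlim : μ (limsup S atTop) = 0 := by
      refine measure_limsup_atTop_eq_zero (ne_top_of_le_ne_top
        (tsum_exp_neg_card_ne_top hgrow (show 0 < s - s' by linarith))
        (ENNReal.tsum_le_tsum hSμ))
    refine measure_mono_null (fun x hx => ?_) hlim
    simp only [mem_compl_iff, mem_ofPred_eq, Classical.not_imp, not_eventually, not_le] at hx
    rw [mem_limsup_iff_frequently_mem]
    exact (hx.2.and_eventually (eventually_ge_atTop N)).mono fun n hn => ⟨hn.2, hx.1, hn.1⟩
  filter_upwards [hZ, ae_all_iff.mpr hnull] with x hx h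
  obtain ⟨i, hi⟩ := mem_iUnion.mp (hcov hx)
  exact h i hi

lemma measEnt_le_packEnt [DecidableEq G] [CompactSpace X] [BorelSpace X] [IsProbabilityMeasure μ]
    (hact_cont : ∀ g, Continuous (act g)) (hinv : InvariantMeasure act μ) (hFol : Folner Fs)
    (hgrow : GrowthCond Fs) {Z : Set X} (hZ : ∀ᵐ x ∂μ, x ∈ Z) :
    measEnt act Fs μ ≤ packEnt act Fs Z := by
  unfold measEnt
  refine iSup_le fun k => iSup_le fun P => iSup_le fun hP => le_of_forall_lt fun a ha => ?_
  obtain ⟨b, hab, hb⟩ := exists_between ha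
  obtain ⟨c, hbc, hc⟩ := exists_between hb
  lift b to ℝ≥0 using (hbc.trans_le le_top).ne
  lift c to ℝ≥0 using (hc.trans_le le_top).ne
  have hbc' : (b : ℝ) < c := by exact_mod_cast hbc
  have hfreq : ∃ᶠ n in atTop, (c : ℝ) * (Fs n).card <
      partEnt μ fun x (g : Fs n) => P (act g x) := by
    refine (frequently_lt_of_lt_limsup (by isBoundedDefault) hc).mono fun n hn => ?_
    rw [ENNReal.lt_ofReal_iff_toReal_lt ENNReal.coe_ne_top, ENNReal.coe_toReal,
      lt_div_iff₀ (by exact_mod_cast (hFol.1 n).card_pos)] at hn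
    exact hn
  obtain ⟨s, hs1, hs2⟩ := exists_between hbc'
  obtain ⟨ε, hε, hnot⟩ := exists_not_ae_le_measure_dynBall hact_cont hinv hFol.1
    (tendsto_card_atTop hgrow) hP hs2 hfreq
  refine hab.trans_le ?_
  unfold packEnt
  refine le_trans ?_ (le_iSup₂ (f := fun ε (_ : 0 < ε) => packEntEps act Fs Z ε) (ε / 3)
    (by positivity))
  unfold packEntEps
  refine le_iInf₂ fun u hu => ?_
  by_contra hcon
  have hub : (u : ℝ) < b := by exact_mod_cast not_le.mp hcon
  exact packOuter_ne_zero hgrow hZ hε (hub.trans hs1) hnot hu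

end LowerPacking

/-! ### Entropy of the empirical measure of a finite set -/

section Empirical

variable {ι : Type*} [DecidableEq ι]

/-- The number of points of `E` having the same `φ`-name as `x` over `S`. -/
def classCard (E : Finset X) (φ : X → G → ι) (S : Finset G) (x : X) : ℕ :=
  (E.filter fun y => ∀ g ∈ S, φ y g = φ x g).card

/-- The entropy over `S` of the uniform measure on `E`, multiplied by the cardinality of `E`. -/
noncomputable def empEnt (E : Finset X) (φ : X → G → ι) (S : Finset G) : ℝ :=
  ∑ x ∈ E, (Real.log E.card - Real.log (classCard E φ S x))

variable {E : Finset X} {φ : X → G → ι}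

lemma classCard_pos {x : X} (hx : x ∈ E) (S : Finset G) : 0 < classCard E φ S x :=
  Finset.card_pos.mpr ⟨x, Finset.mem_filter.mpr ⟨hx, fun _ _ => rfl⟩⟩

lemma empEnt_empty : empEnt E φ ∅ = 0 := by
  simp [empEnt, classCard]

lemma empEnt_of_injOn {F : Finset G}
    (hinj : ∀ x ∈ E, ∀ y ∈ E, (∀ g ∈ F, φ x g = φ y g) → x = y) :
    empEnt E φ F = E.card * Real.log E.card := by
  have : ∀ x ∈ E, classCard E φ F x = 1 := fun x hx => Finset.card_eq_one.mpr
    ⟨x, Finset.eq_singleton_iff_unique_mem.mpr ⟨Finset.mem_filter.mpr ⟨hx, fun _ _ => rfl⟩,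
      fun y hy => hinj y (Finset.mem_filter.mp hy).1 x hx (Finset.mem_filter.mp hy).2⟩⟩
  rw [empEnt, Finset.sum_congr rfl fun x hx => by rw [this x hx]]
  simp

lemma sum_div_card_fiber {W : Type*} [DecidableEq W] (E : Finset X) (w : X → W) (f : W → ℝ) :
    ∑ x ∈ E, f (w x) / (E.filter fun y => w y = w x).card = ∑ v ∈ E.image w, f v := by
  rw [Finset.sum_comp (fun v => f v / (E.filter fun y => w y = v).card) w]
  refine Finset.sum_congr rfl fun v hv => ?_
  obtain ⟨x, hx, rfl⟩ := Finset.mem_image.mp hv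
  have : (0 : ℝ) < (E.filter fun y => w y = w x).card := Nat.cast_pos.mpr
    (Finset.card_pos.mpr ⟨x, Finset.mem_filter.mpr ⟨hx, rfl⟩⟩)
  rw [nsmul_eq_mul]
  field_simp

/-- The Gibbs inequality for the empirical entropy. -/
lemma empEnt_le_of_sum_le_one {W : Type*} [Fintype W] [DecidableEq W] {q : W → ℝ}
    (hq : ∀ v, 0 < q v) (hq1 : ∑ v, q v ≤ 1) (w : X → W) {S : Finset G}
    (hw : ∀ x ∈ E, ∀ y ∈ E, w x = w y → ∀ g ∈ S, φ x g = φ y g) :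
    empEnt E φ S ≤ ∑ x ∈ E, -Real.log (q (w x)) := by
  have hpt : ∀ x ∈ E, Real.log E.card - Real.log (classCard E φ S x) + Real.log (q (w x)) ≤
      E.card * (q (w x) / (E.filter fun y => w y = w x).card) - 1 := by
    intro x hx
    have hE : (0 : ℝ) < E.card := by exact_mod_cast Finset.card_pos.mpr ⟨x, hx⟩
    have hn : (0 : ℝ) < (E.filter fun y => w y = w x).card := Nat.cast_pos.mpr
      (Finset.card_pos.mpr ⟨x, Finset.mem_filter.mpr ⟨hx, rfl⟩⟩)
    have hle : Real.log (E.filter fun y => w y = w x).card ≤ Real.log (classCard E φ S x) := by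
      refine Real.log_le_log hn ?_
      have : (E.filter fun y => w y = w x).card ≤ classCard E φ S x :=
        Finset.card_le_card fun y hy => by
          rw [Finset.mem_filter] at hy ⊢
          exact ⟨hy.1, hw y hy.1 x hx hy.2⟩
      exact_mod_cast this
    have h1 := Real.log_le_sub_one_of_pos (mul_pos hE (div_pos (hq (w x)) hn))
    rw [Real.log_mul hE.ne' (div_pos (hq (w x)) hn).ne', Real.log_div (hq _).ne' hn.ne'] at h1
    linarith
  have h := Finset.sum_le_sum hpt
  rw [Finset.sum_add_distrib, Finset.sum_sub_distrib (f := fun x => (E.card : ℝ) * _),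
    ← Finset.mul_sum, sum_div_card_fiber] at h
  have h2 : ∑ v ∈ E.image w, q v ≤ 1 :=
    (Finset.sum_le_univ_sum_of_nonneg fun v => (hq v).le).trans hq1
  have h3 : (E.card : ℝ) * ∑ v ∈ E.image w, q v ≤ E.card * 1 := by gcongr
  rw [Finset.sum_neg_distrib]
  simp only [Finset.sum_const, nsmul_eq_mul, mul_one] at h h3
  unfold empEnt
  linarith

variable [DecidableEq G]

/-- Submodularity of the empirical entropy. -/
lemma empEnt_insert_sub_le (a : G) {S F : Finset G} (hSF : S ⊆ F) :
    empEnt E φ (insert a F) - empEnt E φ F ≤ empEnt E φ (insert a S) - empEnt E φ S := by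
  set N : Finset G → X → ℝ := fun S x => (classCard E φ S x : ℝ) with hN
  have hpos : ∀ S, ∀ x ∈ E, 0 < N S x := fun S x hx => Nat.cast_pos.mpr (classCard_pos hx S)
  have hNcard : ∀ S x, N S x = ((E.filter fun y => ∀ g ∈ S, φ y g = φ x g).card : ℝ) :=
    fun _ _ => rfl
  have hmain : ∑ x ∈ E, N F x * N (insert a S) x / (N (insert a F) x * N S x) ≤ E.card := by
    have h1 : ∀ x ∈ E, N F x * N (insert a S) x / (N (insert a F) x * N S x) =
        ∑ y ∈ E, if ∀ g ∈ F, φ y g = φ x g then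
          N (insert a S) x / N (insert a F) x / N S y else 0 := by
      intro x hx
      rw [← Finset.sum_filter, Finset.sum_congr rfl (g := fun _ =>
        N (insert a S) x / N (insert a F) x / N S x), Finset.sum_const, nsmul_eq_mul, ← hNcard]
      · rw [mul_div_assoc, div_div]
      · intro y hy
        rw [Finset.mem_filter] at hy
        congr 1
        rw [hNcard, hNcard]
        congr 2
        refine Finset.filter_congr fun z _ => forall₂_congr fun g hg => ?_
        rw [hy.2 g (hSF hg)]
    rw [Finset.sum_congr rfl h1, Finset.sum_comm, ← nsmul_one, ← Finset.sum_const]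
    refine Finset.sum_le_sum fun y hy => ?_
    rw [← Finset.sum_filter, ← Finset.sum_div, div_le_one (hpos S y hy)]
    set Ey := E.filter fun x => ∀ g ∈ F, φ y g = φ x g with hEy
    set T := E.filter fun z => ∀ g ∈ S, φ z g = φ y g with hT
    have h2 : ∀ x ∈ Ey, N (insert a S) x / N (insert a F) x =
        ((T.filter fun z => φ z a = φ x a).card : ℝ) /
          (Ey.filter fun z => φ z a = φ x a).card := by
      intro x hx
      have hx' := (Finset.mem_filter.mp hx).2
      rw [hNcard, hNcard]
      congr 3
      · ext z
        simp only [hT, Finset.mem_filter, Finset.mem_insert, forall_eq_or_imp, and_assoc]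
        refine and_congr_right fun _ => ?_
        rw [and_comm]
        exact and_congr_left fun _ => forall₂_congr fun g hg => by rw [hx' g (hSF hg)]
      · ext z
        simp only [hEy, Finset.mem_filter, Finset.mem_insert, forall_eq_or_imp, and_assoc]
        refine and_congr_right fun _ => ?_
        rw [and_comm]
        exact and_congr_left fun _ => forall₂_congr fun g hg => by rw [hx' g hg, eq_comm]
    rw [Finset.sum_congr rfl h2, sum_div_card_fiber Ey (fun x => φ x a)
      fun v => ((T.filter fun z => φ z a = v).card : ℝ), hNcard]
    have h3 : ∑ v ∈ Ey.image fun x => φ x a, (T.filter fun z => φ z a = v).card ≤ T.card := by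
      rw [Finset.sum_card_fiberwise_eq_card_filter]
      exact Finset.card_filter_le _ _
    exact_mod_cast h3
  have hlog : ∀ x ∈ E, Real.log (N F x) - Real.log (N (insert a F) x) -
      (Real.log (N S x) - Real.log (N (insert a S) x)) ≤
      N F x * N (insert a S) x / (N (insert a F) x * N S x) - 1 := by
    intro x hx
    have p1 := hpos F x hx
    have p2 := hpos (insert a F) x hx
    have p3 := hpos S x hx
    have p4 := hpos (insert a S) x hx
    have h1 := Real.log_le_sub_one_of_pos (div_pos (mul_pos p1 p4) (mul_pos p2 p3))
    rw [Real.log_div (by positivity) (by positivity), Real.log_mul p1.ne' p4.ne',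
      Real.log_mul p2.ne' p3.ne'] at h1
    linarith
  have hsum := Finset.sum_le_sum hlog
  rw [Finset.sum_sub_distrib, Finset.sum_sub_distrib, Finset.sum_sub_distrib,
    Finset.sum_sub_distrib] at hsum
  simp only [Finset.sum_const, nsmul_eq_mul, mul_one] at hsum
  simp only [empEnt, Finset.sum_sub_distrib]
  linarith

lemma empEnt_union_le [Fintype ι] [Nonempty ι] (D F : Finset G) :
    empEnt E φ (D ∪ F) ≤ empEnt E φ F + D.card * (E.card * Real.log (Fintype.card ι)) := by
  induction D using Finset.induction_on with
  | empty => simp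
  | insert a D ha ih =>
    have hk : (0 : ℝ) < Fintype.card ι := Nat.cast_pos.mpr Fintype.card_pos
    have h1 := empEnt_insert_sub_le (E := E) (φ := φ) a (Finset.empty_subset (D ∪ F))
    have h2 : empEnt E φ (insert a ∅) ≤ ∑ x ∈ E, -Real.log ((Fintype.card ι : ℝ)⁻¹) :=
      empEnt_le_of_sum_le_one (q := fun _ : ι => (Fintype.card ι : ℝ)⁻¹)
        (fun _ => inv_pos.mpr hk) (by simp) (fun x => φ x a) (by simp)
    simp only [Real.log_inv, neg_neg, Finset.sum_const, nsmul_eq_mul] at h2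
    rw [empEnt_empty] at h1
    rw [Finset.insert_union, Finset.card_insert_of_notMem ha]
    push_cast
    linarith

/-- The Shearer inequality for the empirical entropy. -/
lemma mul_empEnt_le_sum {κ : Type*} (C : Finset κ) (T : κ → Finset G) (j : ℕ) (F : Finset G)
    (hF : ∀ f ∈ F, (C.filter fun c => f ∈ T c).card = j) :
    j * empEnt E φ F ≤ ∑ c ∈ C, empEnt E φ (F ∩ T c) := by
  induction F using Finset.induction_on with
  | empty => simp [empEnt_empty]
  | insert a F ha ih =>
    have ih' := ih fun f hf => hF f (Finset.mem_insert_of_mem hf)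
    have hstep : ∀ c ∈ C, empEnt E φ (F ∩ T c) +
        (if a ∈ T c then empEnt E φ (insert a F) - empEnt E φ F else 0) ≤
        empEnt E φ (insert a F ∩ T c) := by
      intro c _
      split_ifs with h
      · rw [Finset.insert_inter_of_mem h]
        have := empEnt_insert_sub_le (E := E) (φ := φ) a
          (Finset.inter_subset_left : F ∩ T c ⊆ F)
        linarith
      · rw [Finset.insert_inter_of_notMem h, add_zero]
    have h := Finset.sum_le_sum hstep
    rw [Finset.sum_add_distrib, ← Finset.sum_filter, Finset.sum_const, nsmul_eq_mul,
      hF a (Finset.mem_insert_self _ _)] at h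
    linarith

/-- Counting words over a large set by means of the statistics of its windows of shape `K`. -/
lemma card_mul_log_card_le [Group G] [Fintype ι] [Nonempty ι] {act : G → X → X}
    (hact_mul : ∀ g h x, act (g * h) x = act g (act h x)) {P : X → ι} {F K : Finset G}
    (hE : E.Nonempty)
    (hinj : ∀ x ∈ E, ∀ y ∈ E, (∀ g ∈ F, P (act g x) = P (act g y)) → x = y)
    {q : (K → ι) → ℝ} (hq : ∀ v, 0 < q v) (hq1 : ∑ v, q v ≤ 1) {B : ℝ}
    (hB : ∀ x ∈ E, ∑ c ∈ F, -Real.log (q fun g => P (act g (act c x))) ≤ B) :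
    K.card * Real.log E.card ≤ K.card * ((F.filter fun f => ¬ ∀ κ ∈ K, κ⁻¹ * f ∈ F).card *
      Real.log (Fintype.card ι)) + B := by
  set F' := F.filter fun f => ∀ κ ∈ K, κ⁻¹ * f ∈ F with hF'
  set φ : X → G → ι := fun x g => P (act g x) with hφ
  have h1 : empEnt E φ F = E.card * Real.log E.card := empEnt_of_injOn hinj
  have h2 := empEnt_union_le (E := E) (φ := φ) (F.filter fun f => ¬ ∀ κ ∈ K, κ⁻¹ * f ∈ F) F'
  rw [Finset.union_comm, hF', Finset.filter_union_filter_not_eq, ← hF', h1] at h2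
  have h3 := mul_empEnt_le_sum (E := E) (φ := φ) F (fun c => K.image fun κ => κ * c) K.card F' <| by
    intro f hf
    have hf' := (Finset.mem_filter.mp hf).2
    have : (F.filter fun c => f ∈ K.image fun κ => κ * c) = K.image fun κ => κ⁻¹ * f := by
      ext c
      simp only [Finset.mem_filter, Finset.mem_image]
      constructor
      · rintro ⟨_, κ, hκ, rfl⟩
        exact ⟨κ, hκ, by group⟩
      · rintro ⟨κ, hκ, rfl⟩
        exact ⟨hf' κ hκ, κ, hκ, by group⟩
    rw [this, Finset.card_image_of_injective]
    intro a b hab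
    simpa using hab
  have h4 : ∀ c ∈ F, empEnt E φ (F' ∩ K.image fun κ => κ * c) ≤
      ∑ x ∈ E, -Real.log (q fun g => P (act g (act c x))) := by
    intro c _
    refine empEnt_le_of_sum_le_one hq hq1 (fun x g => P (act g (act c x)))
      fun x _ y _ hxy g hg => ?_
    obtain ⟨κ, hκ, rfl⟩ := Finset.mem_image.mp (Finset.mem_inter.mp hg).2
    simpa only [hφ, hact_mul] using congrFun hxy ⟨κ, hκ⟩
  have h5 := h3.trans (Finset.sum_le_sum h4)
  rw [Finset.sum_comm] at h5
  have h6 := h5.trans (Finset.sum_le_sum hB)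
  rw [Finset.sum_const, nsmul_eq_mul] at h6
  have hE0 : (0 : ℝ) < E.card := by exact_mod_cast hE.card_pos
  have h7 := mul_le_mul_of_nonneg_left h2 (Nat.cast_nonneg (α := ℝ) K.card)
  refine le_of_mul_le_mul_left ?_ hE0
  linarith

end Empirical

/-! ### Upper bound -/

section Packing

variable [MetricSpace X] {act : G → X → X} {Fs : ℕ → Finset G}

/-- A uniform bound for the cardinality of disjoint families bounds the packing pre-measure. -/
lemma packP_le_tsum {Z : Set X} {N : ℕ} {ε s s' : ℝ} (hε : 0 ≤ ε)
    (hcard : ∀ n ≥ N, ∀ E : Finset X, ↑E ⊆ Z → (E : Set X).Pairwise (fun x y =>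
      Disjoint (dynClosedBall act (Fs n) x ε) (dynClosedBall act (Fs n) y ε)) →
      (E.card : ℝ) ≤ Real.exp (s' * (Fs n).card)) :
    packP act Fs Z N ε s ≤
      ∑' n, ENNReal.ofReal (Real.exp (-(s - s') * (Fs (n + N)).card)) := by
  classical
  unfold packP
  refine iSup_le fun t => iSup_le fun c => iSup_le fun h1 => iSup_le fun h2 => ?_
  rw [← ENNReal.tsum_fiberwise _ fun i : t => (c i).2 - N]
  refine ENNReal.tsum_le_tsum fun m => ?_
  rw [ENNReal.tsum_eq_iSup_sum]
  refine iSup_le fun u => ?_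
  set n := m + N with hn
  have hcn : ∀ i : (fun i : t => (c i).2 - N) ⁻¹' {m}, (c i).2 = n := by
    intro i
    have h3 := (h1 i i.1.2).2
    have h4 : (c i).2 - N = m := i.2
    omega
  have hne : ∀ i j : (fun i : t => (c i).2 - N) ⁻¹' {m}, i ≠ j →
      Disjoint (dynClosedBall act (Fs n) (c i).1 ε) (dynClosedBall act (Fs n) (c j).1 ε) := by
    intro i j hij
    have := h2 i i.1.2 j j.1.2 fun h => hij (Subtype.ext (Subtype.ext h))
    rwa [hcn i, hcn j] at this
  have hinj : ∀ i j : (fun i : t => (c i).2 - N) ⁻¹' {m}, (c i).1 = (c j).1 → i = j := by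
    intro i j hij
    by_contra hcon
    have := hne i j hcon
    rw [hij] at this
    exact disjoint_left.mp this (mem_dynClosedBall_self _ _ hε) (mem_dynClosedBall_self _ _ hε)
  have hE := hcard n (Nat.le_add_left _ _)
    (u.image fun i : (fun i : t => (c i).2 - N) ⁻¹' {m} => (c i).1)
    (fun x hx => by
      obtain ⟨i, _, rfl⟩ := Finset.mem_image.mp hx
      exact (h1 i i.1.2).1)
    (fun x hx y hy hxy => by
      obtain ⟨i, _, rfl⟩ := Finset.mem_image.mp hx
      obtain ⟨j, _, rfl⟩ := Finset.mem_image.mp hy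
      exact hne i j fun h => hxy (by rw [h]))
  rw [Finset.card_image_of_injective _ fun i j => hinj i j] at hE
  calc ∑ i ∈ u, ENNReal.ofReal (Real.exp (-s * (Fs (c i).2).card))
      = ∑ _i ∈ u, ENNReal.ofReal (Real.exp (-s * (Fs n).card)) :=
        Finset.sum_congr rfl fun i _ => by rw [hcn i]
    _ = ENNReal.ofReal (u.card * Real.exp (-s * (Fs n).card)) := by
        rw [Finset.sum_const, nsmul_eq_mul, ENNReal.ofReal_mul (Nat.cast_nonneg _),
          ENNReal.ofReal_natCast]
    _ ≤ ENNReal.ofReal (Real.exp (s' * (Fs n).card) * Real.exp (-s * (Fs n).card)) := by gcongr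
    _ = _ := by rw [← Real.exp_add]; ring_nf

lemma packPLim_eq_zero [Group G] (hgrow : GrowthCond Fs) {Z : Set X} {ε s s' : ℝ} (hε : 0 ≤ ε)
    (hs : s' < s)
    (hcard : ∀ᶠ n in atTop, ∀ E : Finset X, ↑E ⊆ Z → (E : Set X).Pairwise (fun x y =>
      Disjoint (dynClosedBall act (Fs n) x ε) (dynClosedBall act (Fs n) y ε)) →
      (E.card : ℝ) ≤ Real.exp (s' * (Fs n).card)) :
    packPLim act Fs Z ε s = 0 := by
  obtain ⟨N₀, hN₀⟩ := eventually_atTop.mp hcard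
  have hlim := ENNReal.tendsto_sum_nat_add
    (fun n => ENNReal.ofReal (Real.exp (-(s - s') * (Fs n).card)))
    (tsum_exp_neg_card_ne_top hgrow (show 0 < s - s' by linarith))
  refine le_antisymm (ge_of_tendsto hlim ?_) zero_le
  filter_upwards [eventually_ge_atTop N₀] with N hN
  exact (iInf_le _ N).trans (packP_le_tsum hε fun n hn => hN₀ n (hN.trans hn))

end Packing

/-- Most elements of a Følner set `F` satisfy `K⁻¹ f ⊆ F`. -/
lemma Folner.tendsto_card_filter_div [Group G] [DecidableEq G] {Fs : ℕ → Finset G}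
    (hFol : Folner Fs) (K : Finset G) :
    Tendsto (fun n => (((Fs n).filter fun f => ¬ ∀ κ ∈ K, κ⁻¹ * f ∈ Fs n).card : ℝ) /
      (Fs n).card) atTop (𝓝 0) := by
  have hlim := tendsto_finsetSum K fun κ _ => hFol.2 κ
  rw [Finset.sum_const_zero] at hlim
  refine squeeze_zero (fun n => by positivity) (fun n => ?_) hlim
  rw [← Finset.sum_div]
  gcongr
  have hsub : ((Fs n).filter fun f => ¬ ∀ κ ∈ K, κ⁻¹ * f ∈ Fs n) ⊆
      K.biUnion fun κ => ((Fs n).image fun h => κ * h) ∆ Fs n := by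
    intro f hf
    rw [Finset.mem_filter] at hf
    obtain ⟨hfF, hf⟩ := hf
    push Not at hf
    obtain ⟨κ, hκ, hκf⟩ := hf
    refine Finset.mem_biUnion.mpr ⟨κ, hκ, Finset.mem_symmDiff.mpr (Or.inr ⟨hfF, fun h => hκf ?_⟩)⟩
    obtain ⟨h', hh', rfl⟩ := Finset.mem_image.mp h
    rwa [inv_mul_cancel_left]
  exact_mod_cast (Finset.card_le_card hsub).trans Finset.card_biUnion_le

/-- A compact metric space has a finite measurable partition into sets of small diameter that is
locally constant off a closed null set. -/
lemma exists_partition_null_boundary [MetricSpace X] [CompactSpace X] [MeasurableSpace X]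
    [BorelSpace X] (μ : Measure X) [IsFiniteMeasure μ] {ε : ℝ} (hε : 0 < ε) :
    ∃ (k : ℕ) (P : X → Fin k) (D : Set X), Measurable P ∧ μ D = 0 ∧
      (∀ x ∉ D, ∀ᶠ y in 𝓝 x, P y = P x) ∧ ∀ x y, P x = P y → dist x y ≤ ε := by
  classical
  have hr : ∀ x : X, ∃ r ∈ Ioo 0 (ε / 2), μ (frontier (Metric.ball x r)) = 0 := by
    intro x
    obtain ⟨r, hr, h⟩ := exists_null_frontier_thickening μ {x} (show 0 < ε / 2 by positivity)
    rw [Metric.thickening_singleton] at h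
    exact ⟨r, hr, h⟩
  choose r hr hμ using hr
  obtain ⟨T, hT⟩ := isCompact_univ.elim_finite_subcover (fun x => Metric.ball x (r x))
    (fun x => Metric.isOpen_ball) fun x _ => mem_iUnion.mpr ⟨x, Metric.mem_ball_self (hr x).1⟩
  set P₀ : X → (T → Bool) := fun x j => decide (x ∈ Metric.ball (j : X) (r j)) with hP₀
  have hP₀m : Measurable P₀ := measurable_pi_lambda _ fun j => by
    refine measurable_to_bool ?_
    have : (fun x => decide (x ∈ Metric.ball (j : X) (r j))) ⁻¹' {true} =
        Metric.ball (j : X) (r j) := by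
      ext; simp
    rw [this]
    exact measurableSet_ball
  set e := Fintype.equivFin (T → Bool)
  refine ⟨_, fun x => e (P₀ x), ⋃ j ∈ T, frontier (Metric.ball j (r j)),
    (measurable_of_finite e).comp hP₀m, ?_, ?_, ?_⟩
  · exact (measure_biUnion_null_iff T.countable_toSet).mpr fun j _ => hμ j
  · intro x hx
    simp only [mem_iUnion, not_exists] at hx
    have h1 : ∀ j : T, ∀ᶠ y in 𝓝 x, P₀ y j = P₀ x j := by
      intro j
      by_cases hxj : x ∈ Metric.ball (j : X) (r j)
      · filter_upwards [Metric.isOpen_ball.mem_nhds hxj] with y hy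
        simp only [hP₀, hy, hxj]
      · have hcl : x ∉ closure (Metric.ball (j : X) (r j)) := by
          intro hcl
          refine hx j j.2 ?_
          rw [Metric.isOpen_ball.frontier_eq]
          exact ⟨hcl, hxj⟩
        filter_upwards [isClosed_closure.isOpen_compl.mem_nhds hcl] with y hy
        have hy' : y ∉ Metric.ball (j : X) (r j) := fun h => hy (subset_closure h)
        simp only [hP₀, hy', hxj]
    filter_upwards [eventually_all.mpr h1] with y hy
    rw [show P₀ y = P₀ x from funext hy]
  · intro x y hxy
    have hxy' : P₀ x = P₀ y := e.injective hxy
    obtain ⟨j, hj, hxj⟩ := mem_iUnion₂.mp (hT (mem_univ x))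
    have h1 := congrFun hxy' ⟨j, hj⟩
    have hyj : y ∈ Metric.ball j (r j) := by
      simpa [hP₀, Metric.mem_ball.mp hxj] using h1.symm
    have h2 := Metric.mem_ball.mp hxj
    have h3 := Metric.mem_ball.mp hyj
    have h4 := dist_triangle_right x y j
    have h5 := (hr j).2
    linarith

/-- Almost optimal code lengths for an approximation of a probability vector. -/
lemma exists_pos_sum_neg_log_lt {W : Type*} [Fintype W] {a : W → ℝ} (ha : ∀ w, 0 ≤ a w)
    (ha1 : ∑ w, a w = 1) {h : ℝ} (hh : ∑ w, Real.negMulLog (a w) < h) :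
    ∃ η : ℝ, 0 < η ∧ ∃ q : W → ℝ, (∀ w, 0 < q w) ∧ ∑ w, q w = 1 ∧
      ∑ w, -Real.log (q w) * (a w + η) < h := by
  set L : ℝ := (Fintype.card W : ℝ) with hL
  set B : ℝ → ℝ := fun η => ∑ w, (Real.negMulLog (a w + η) + (a w + η) * Real.log (1 + η * L))
    with hB
  have hcont : ContinuousAt B 0 := by
    refine tendsto_finsetSum _ fun w _ => ?_
    refine ContinuousAt.add (f := fun η => Real.negMulLog (a w + η)) (by fun_prop) ?_
    refine ContinuousAt.mul (f := fun η => a w + η) (by fun_prop) ?_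
    exact ContinuousAt.log (by fun_prop) (by simp)
  have hB0 : B 0 < h := by simpa [hB] using hh
  have hev : ∀ᶠ η in 𝓝[>] (0 : ℝ), B η < h :=
    (hcont.eventually_lt_const hB0).filter_mono nhdsWithin_le_nhds
  obtain ⟨η, hη, hη0⟩ := (hev.and self_mem_nhdsWithin).exists
  have hη0' : 0 < η := hη0
  have hL0 : 0 ≤ L := Nat.cast_nonneg _
  have hden : 0 < 1 + η * L := by positivity
  have hnum : ∀ w, 0 < a w + η := fun w => by linarith [ha w]
  refine ⟨η, hη0, fun w => (a w + η) / (1 + η * L), fun w => div_pos (hnum w) hden, ?_, ?_⟩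
  · rw [← Finset.sum_div, Finset.sum_add_distrib, ha1, Finset.sum_const, Finset.card_univ,
      nsmul_eq_mul, ← hL, mul_comm L]
    exact div_self hden.ne'
  · refine (le_of_eq (Finset.sum_congr rfl fun w _ => ?_)).trans_lt hη
    rw [Real.log_div (hnum w).ne' hden.ne', Real.negMulLog]
    ring

section Upper

variable [MetricSpace X] [MeasurableSpace X] {act : G → X → X}
  {μ : Measure X}

/-- The cells of a refined partition inherit null boundaries. -/
lemma measure_closure_cylinder_le (hact_cont : ∀ g, Continuous (act g))
    (hinv : InvariantMeasure act μ) {ι : Type*} {P : X → ι} {D : Set X} (hD : μ D = 0)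
    (hP : ∀ x ∉ D, ∀ᶠ y in 𝓝 x, P y = P x) (K : Finset G) (w : K → ι) :
    μ (closure {x | (fun g : K => P (act g x)) = w}) ≤
      μ {x | (fun g : K => P (act g x)) = w} := by
  obtain ⟨D', hDD', hD'm, hD'⟩ := exists_measurable_superset_of_null hD
  have hnull : μ (⋃ g : K, act g ⁻¹' D') = 0 :=
    measure_iUnion_null fun g => by rw [hinv g D' hD'm, hD']
  refine (measure_mono (fun x hx => ?_)).trans
    ((measure_union_le {x | (fun g : K => P (act g x)) = w} (⋃ g : K, act g ⁻¹' D')).trans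
      (by rw [hnull, add_zero]))
  by_cases hxD : x ∈ ⋃ g : K, act g ⁻¹' D'
  · exact Or.inr hxD
  refine Or.inl ?_
  have hev : ∀ᶠ y in 𝓝 x, ∀ g : K, P (act g y) = P (act g x) := by
    refine eventually_all.mpr fun g => (hact_cont g).continuousAt.eventually (hP _ fun h => ?_)
    exact hxD (mem_iUnion.mpr ⟨g, hDD' h⟩)
  obtain ⟨y, hy1, hy2⟩ := (mem_closure_iff_frequently.mp hx).and_eventually hev |>.exists
  rw [mem_ofPred_eq] at hy1 ⊢
  rw [← hy1]
  exact funext fun g => (hy2 g).symm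

variable [BorelSpace X]

lemma exists_continuous_ge_one_integral_lt [IsFiniteMeasure μ] {A : Set X}
    (hA : μ (closure A) ≤ μ A) {η : ℝ} (hη : 0 < η) :
    ∃ f : C(X, ℝ), (∀ x, 0 ≤ f x) ∧ (∀ x ∈ A, 1 ≤ f x) ∧ ∫ x, f x ∂μ < μ.real A + η := by
  have hcl : IsClosed (closure A) := isClosed_closure
  have hlim := HasOuterApproxClosed.tendsto_lintegral_apprSeq hcl μ
  have hlt : μ (closure A) < ENNReal.ofReal (μ.real A + η) := by
    refine hA.trans_lt ((ENNReal.lt_ofReal_iff_toReal_lt (measure_ne_top _ _)).mpr ?_)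
    rw [Measure.real]
    linarith
  obtain ⟨n, hn⟩ := (hlim.eventually_lt_const hlt).exists
  refine ⟨⟨fun x => (hcl.apprSeq n x : ℝ), NNReal.continuous_coe.comp (hcl.apprSeq n).continuous⟩,
    fun x => NNReal.coe_nonneg _, fun x hx => ?_, ?_⟩
  · simp [HasOuterApproxClosed.apprSeq_apply_eq_one hcl n (subset_closure hx)]
  · rw [ENNReal.lt_ofReal_iff_toReal_lt hn.ne_top,
      BoundedContinuousFunction.toReal_lintegral_coe_eq_integral] at hn
    exact hn

/-- Window frequencies along the orbit of a generic point. -/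
lemma eventually_card_filter_le {Fs : ℕ → Finset G} (hne : ∀ n, (Fs n).Nonempty) {x : X}
    (hx : x ∈ genericPoints act Fs μ) [IsFiniteMeasure μ] {A : Set X} [DecidablePred (· ∈ A)]
    (hA : μ (closure A) ≤ μ A) {η : ℝ} (hη : 0 < η) :
    ∀ᶠ n in atTop,
      (((Fs n).filter fun c => act c x ∈ A).card : ℝ) ≤ (Fs n).card * (μ.real A + η) := by
  obtain ⟨f, hf0, hf1, hfi⟩ := exists_continuous_ge_one_integral_lt hA hη
  filter_upwards [(hx f).eventually_lt_const hfi] with n hn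
  rw [div_lt_iff₀ (by exact_mod_cast (hne n).card_pos)] at hn
  rw [mul_comm, Finset.card_filter]
  push_cast
  refine (Finset.sum_le_sum fun c _ => ?_).trans hn.le
  split_ifs with h
  · exact hf1 _ h
  · exact hf0 _

variable [CompactSpace X] [Group G] [DecidableEq G] [IsProbabilityMeasure μ] {Fs : ℕ → Finset G}

lemma packOuter_genericPoints_eq_zero
    (hact_mul : ∀ g h x, act (g * h) x = act g (act h x)) (hact_cont : ∀ g, Continuous (act g))
    (hinv : InvariantMeasure act μ) (hFol : Folner Fs) (hgrow : GrowthCond Fs) {ε s : ℝ}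
    (hε : 0 < ε) (hs : measEnt act Fs μ < ENNReal.ofReal s) :
    packOuter act Fs (genericPoints act Fs μ) ε s = 0 := by
  obtain ⟨k, P, D, hPm, hD, hPD, hPε⟩ := exists_partition_null_boundary μ hε
  have hX : Nonempty X := nonempty_of_isProbabilityMeasure μ
  have hk : Nonempty (Fin k) := hX.map P
  have hlog : 0 ≤ Real.log k := Real.log_natCast_nonneg k
  -- a window with small normalized entropy
  have hlimsup : limsup (fun n => ENNReal.ofReal
      ((partEnt μ fun x (g : (Fs n : Finset G)) => P (act (g : G) x)) / ((Fs n).card : ℝ)))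
      atTop < ENNReal.ofReal s := by
    refine lt_of_le_of_lt ?_ hs
    unfold measEnt
    exact le_iSup_of_le k (le_iSup_of_le P (le_iSup_of_le hPm le_rfl))
  obtain ⟨m, hm⟩ := (eventually_lt_of_limsup_lt hlimsup (by isBoundedDefault)).exists
  have hs0 : 0 < s := ENNReal.ofReal_pos.mp (zero_le.trans_lt hs)
  rw [ENNReal.ofReal_lt_ofReal_iff hs0] at hm
  set K := Fs m with hK
  have hK0 : (0 : ℝ) < K.card := by exact_mod_cast (hFol.1 m).card_pos
  obtain ⟨s₂, hs₂, hs₂s⟩ := exists_between hm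
  obtain ⟨s₁, hs₁, hs₁s⟩ := exists_between hs₂s
  rw [div_lt_iff₀ hK0] at hs₂
  set cell : (K → Fin k) → Set X := fun w => {x | (fun g : K => P (act g x)) = w} with hcell
  have hname : Measurable fun x (g : K) => P (act g x) :=
    measurable_pi_lambda _ fun g => hPm.comp (hact_cont g).measurable
  have hsum : ∑ w, μ.real (cell w) = 1 := by
    have h := sum_measureReal_preimage_singleton (μ := μ) (f := fun x (g : K) => P (act g x))
      Finset.univ fun w _ => hname (measurableSet_singleton w)
    rw [Finset.coe_univ, preimage_univ, probReal_univ] at h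
    exact h
  obtain ⟨η, hη, q, hq, hq1, hqlt⟩ := exists_pos_sum_neg_log_lt (a := fun w => μ.real (cell w))
    (fun _ => measureReal_nonneg) hsum hs₂
  have hq0 : ∀ w, 0 ≤ -Real.log (q w) := by
    intro w
    rw [neg_nonneg]
    refine Real.log_nonpos (hq w).le ?_
    rw [← hq1]
    exact Finset.single_le_sum (f := q) (fun w _ => (hq w).le) (Finset.mem_univ w)
  set Z : ℕ → Set X := fun N => {x | ∀ n ≥ N, ∀ w,
    (((Fs n).filter fun c => (fun g : K => P (act g (act c x))) = w).card : ℝ) ≤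
      (Fs n).card * (μ.real (cell w) + η)} with hZ
  have hcov : genericPoints act Fs μ ⊆ ⋃ N, Z N := by
    intro x hx
    have hev : ∀ᶠ n in atTop, ∀ w,
        (((Fs n).filter fun c => (fun g : K => P (act g (act c x))) = w).card : ℝ) ≤
          (Fs n).card * (μ.real (cell w) + η) := by
      refine eventually_all.mpr fun w => ?_
      have hdec : DecidablePred (· ∈ cell w) := Classical.decPred _
      filter_upwards [eventually_card_filter_le hFol.1 hx (A := cell w)
        (measure_closure_cylinder_le hact_cont hinv hD hPD K w) hη] with n hn
      refine le_of_eq_of_le ?_ hn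
      congr 2
      exact Finset.filter_congr fun c _ => Iff.rfl
    obtain ⟨N, hN⟩ := eventually_atTop.mp hev
    exact mem_iUnion.mpr ⟨N, hN⟩
  have hbdry : ∀ᶠ n in atTop, (((Fs n).filter fun f => ¬ ∀ κ ∈ K, κ⁻¹ * f ∈ Fs n).card : ℝ) /
      (Fs n).card < (s₁ - s₂) / (Real.log k + 1) :=
    (hFol.tendsto_card_filter_div K).eventually_lt_const (div_pos (by linarith) (by linarith))
  have hZ0 : ∀ N, packPLim act Fs (Z N) ε s = 0 := by
    intro N
    refine packPLim_eq_zero hgrow hε.le hs₁s ?_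
    filter_upwards [hbdry, eventually_ge_atTop N] with n hn hNn E hEZ hEd
    rcases E.eq_empty_or_nonempty with rfl | hE
    · simpa using (Real.exp_pos _).le
    have hF0 : (0 : ℝ) < (Fs n).card := by exact_mod_cast (hFol.1 n).card_pos
    have hinj : ∀ x ∈ E, ∀ y ∈ E, (∀ g ∈ Fs n, P (act g x) = P (act g y)) → x = y := by
      intro x hx y hy hxy
      by_contra hne
      exact disjoint_left.mp (hEd hx hy hne) (fun g hg => hPε _ _ (hxy g hg))
        (mem_dynClosedBall_self _ _ hε.le)
    have hB : ∀ x ∈ E, ∑ c ∈ Fs n, -Real.log (q fun g => P (act g (act c x))) ≤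
        (Fs n).card * (s₂ * K.card) := by
      intro x hx
      have hxZ := hEZ hx n hNn
      rw [← Finset.sum_fiberwise (Fs n) fun c (g : K) => P (act g (act c x))]
      calc _ = ∑ w, (((Fs n).filter fun c => (fun g : K => P (act g (act c x))) = w).card : ℝ) *
            -Real.log (q w) := by
              refine Finset.sum_congr rfl fun w _ => ?_
              rw [Finset.sum_congr rfl fun c hc => by rw [(Finset.mem_filter.mp hc).2],
                Finset.sum_const, nsmul_eq_mul]
        _ ≤ ∑ w, (Fs n).card * (μ.real (cell w) + η) * -Real.log (q w) :=
            Finset.sum_le_sum fun w _ => mul_le_mul_of_nonneg_right (hxZ w) (hq0 w)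
        _ = (Fs n).card * ∑ w, -Real.log (q w) * (μ.real (cell w) + η) := by
            rw [Finset.mul_sum]
            exact Finset.sum_congr rfl fun w _ => by ring
        _ ≤ _ := mul_le_mul_of_nonneg_left hqlt.le hF0.le
    have key := card_mul_log_card_le hact_mul hE hinj hq hq1.le hB
    rw [Fintype.card_fin] at key
    rw [div_lt_iff₀ hF0, div_mul_eq_mul_div, lt_div_iff₀ (by linarith)] at hn
    set b : ℝ := (((Fs n).filter fun f => ¬ ∀ κ ∈ K, κ⁻¹ * f ∈ Fs n).card : ℝ) with hb
    have hb0 : 0 ≤ b := Nat.cast_nonneg _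
    have h1 : (K.card : ℝ) * Real.log E.card ≤ K.card * (s₁ * (Fs n).card) := by
      have h2 : b * Real.log k ≤ (s₁ - s₂) * (Fs n).card := by linarith
      have h3 := mul_le_mul_of_nonneg_left h2 hK0.le
      linarith
    exact (Real.log_le_iff_le_exp (by exact_mod_cast hE.card_pos)).mp
      (le_of_mul_le_mul_left h1 hK0)
  refine le_antisymm ((iInf₂_le Z hcov).trans ?_) zero_le
  simp [hZ0]

lemma packEnt_genericPoints_le_measEnt
    (hact_mul : ∀ g h x, act (g * h) x = act g (act h x)) (hact_cont : ∀ g, Continuous (act g))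
    (hinv : InvariantMeasure act μ) (hFol : Folner Fs) (hgrow : GrowthCond Fs) :
    packEnt act Fs (genericPoints act Fs μ) ≤ measEnt act Fs μ := by
  refine iSup₂_le fun ε hε => le_of_forall_gt fun a ha => ?_
  obtain ⟨b, hab, hb⟩ := exists_between ha
  lift b to ℝ≥0 using (hb.trans_le le_top).ne
  refine (iInf₂_le b ?_).trans_lt hb
  exact packOuter_genericPoints_eq_zero hact_mul hact_cont hinv hFol hgrow hε
    (by rwa [ENNReal.ofReal_coe_nnreal])

end Upper

theorem packing_entropy_generic_points_ergodic
    [Group G] [Countable G] [Infinite G] [DecidableEq G]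
    [MetricSpace X] [CompactSpace X] [MeasurableSpace X] [BorelSpace X]
    (act : G → X → X)
    (hact_one : ∀ x, act 1 x = x)
    (hact_mul : ∀ g h x, act (g * h) x = act g (act h x))
    (hact_cont : ∀ g : G, Continuous (act g))
    (Fs : ℕ → Finset G) (hFol : Folner Fs) (htemp : Tempered Fs) (hgrow : GrowthCond Fs)
    (μ : Measure X) [IsProbabilityMeasure μ] (hinv : InvariantMeasure act μ)
    (herg : ErgodicAction act μ) :
    packEnt act Fs (genericPoints act Fs μ) = measEnt act Fs μ := by
  exact le_antisymm (packEnt_genericPoints_le_measEnt hact_mul hact_cont hinv hFol hgrow)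
    (measEnt_le_packEnt hact_cont hinv hFol hgrow
      (ae_mem_genericPoints hact_one hact_mul hact_cont hinv herg hFol htemp))

end AmenablePacking
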